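/- arXiv:1901.07476 — 3 statements merged into one kernel-verified Lean document; each statement's English description precedes it below -/
import Mathlib

section
/- For every quadruple of jointly distributed random variables (A,B,C,D) taking finitely many values, with H(A,B,C,D) > 0, the Ingleton score satisfies Ing(A,B,C,D)/H(A,B,C,D) ≥ −3/19; equivalently, I(A;B|C) + I(A;B|D) + I(C;D) − I(A;B) + (3/19)·H(A,B,C,D) ≥ 0. -/
open scoped Classical

/-- Shannon entropy (natural-log base) of a random variable `X` defined on a finite
probability space `(Ω, p)` and taking values in a finite type `α`. -/
noncomputable def ent {Ω α : Type*} [Fintype Ω] [Fintype α] (p : Ω → ℝ) (X : Ω → α) : ℝ :=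
  ∑ a : α, Real.negMulLog (∑ ω : Ω, if X ω = a then p ω else 0)

namespace Ingl

universe u v

/-- Probability of the fibre of `X` through `ω`. -/
noncomputable def Q {Ω τ : Type*} [Fintype Ω] (p : Ω → ℝ) (X : Ω → τ) (ω : Ω) : ℝ :=
  ∑ ν : Ω, if X ν = X ω then p ν else 0

/-- Entropy written as an expectation over the probability space. -/
noncomputable def G {Ω τ : Type*} [Fintype Ω] (p : Ω → ℝ) (X : Ω → τ) : ℝ :=
  -∑ ω : Ω, p ω * Real.log (Q p X ω)

theorem ent_eq_G {Ω α : Type*} [Fintype Ω] [Fintype α] (p : Ω → ℝ) (X : Ω → α) :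
    ent p X = G p X := by
  unfold ent G
  have h : ∀ a : α, Real.negMulLog (∑ ω : Ω, if X ω = a then p ω else 0)
      = ∑ ω : Ω, if X ω = a then -(p ω * Real.log (Q p X ω)) else 0 := by
    intro a
    rw [Real.negMulLog, neg_mul, Finset.sum_mul, ← Finset.sum_neg_distrib]
    refine Finset.sum_congr rfl fun ω _ => ?_
    by_cases h : X ω = a
    · subst h; simp [Q]
    · simp [h]
  simp_rw [h]
  rw [Finset.sum_comm]
  simp

theorem Q_nonneg {Ω τ : Type*} [Fintype Ω] {p : Ω → ℝ} (hp0 : ∀ ω, 0 ≤ p ω) (X : Ω → τ)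
    (ω : Ω) : 0 ≤ Q p X ω :=
  Finset.sum_nonneg fun ω' _ => by split_ifs <;> simp [hp0]

theorem le_Q {Ω τ : Type*} [Fintype Ω] {p : Ω → ℝ} (hp0 : ∀ ω, 0 ≤ p ω) (X : Ω → τ)
    (ω : Ω) : p ω ≤ Q p X ω := by
  have := Finset.single_le_sum (f := fun ω' => if X ω' = X ω then p ω' else 0)
    (fun ω' _ => by split_ifs <;> simp [hp0]) (Finset.mem_univ ω)
  simpa [Q] using this

theorem Q_pos {Ω τ : Type*} [Fintype Ω] {p : Ω → ℝ} (hp0 : ∀ ω, 0 ≤ p ω) (X : Ω → τ)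
    {ω : Ω} (h : 0 < p ω) : 0 < Q p X ω := lt_of_lt_of_le h (le_Q hp0 X ω)

theorem G_congr {Ω τ τ' : Type*} [Fintype Ω] {p : Ω → ℝ} (X : Ω → τ) (Y : Ω → τ')
    (h : ∀ ω ω', p ω ≠ 0 → p ω' ≠ 0 → (X ω' = X ω ↔ Y ω' = Y ω)) : G p X = G p Y := by
  unfold G
  congr 1
  refine Finset.sum_congr rfl fun ω _ => ?_
  by_cases h0 : p ω = 0
  · simp [h0]
  congr 2
  refine Finset.sum_congr rfl fun ω' _ => ?_
  by_cases h1 : p ω' = 0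
  · simp [h1]
  simp [h ω ω' h0 h1]

theorem Q_congr_pt {Ω τ : Type*} [Fintype Ω] {p : Ω → ℝ} (X : Ω → τ) {ω ω' : Ω}
    (h : X ω' = X ω) : Q p X ω' = Q p X ω := by
  unfold Q; rw [h]

theorem G_mono {Ω τ τ' : Type*} [Fintype Ω] {p : Ω → ℝ} (hp0 : ∀ ω, 0 ≤ p ω)
    (X : Ω → τ) (Y : Ω → τ') (h : ∀ ω ω', Y ω' = Y ω → X ω' = X ω) : G p X ≤ G p Y := by
  unfold G
  rw [neg_le_neg_iff]
  refine Finset.sum_le_sum fun ω _ => ?_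
  rcases (hp0 ω).eq_or_lt with h0 | h0
  · simp [← h0]
  refine mul_le_mul_of_nonneg_left (Real.log_le_log (Q_pos hp0 _ h0) ?_) h0.le
  refine Finset.sum_le_sum fun ω' _ => ?_
  by_cases hy : Y ω' = Y ω
  · simp [hy, h ω ω' hy]
  · simp only [hy, if_false]; split_ifs <;> simp [hp0]

theorem submod {Ω τ₁ τ₂ τ₃ τ₄ : Type*} [Fintype Ω] {p : Ω → ℝ} (hp0 : ∀ ω, 0 ≤ p ω)
    (hp1 : ∑ ω, p ω = 1)
    (U : Ω → τ₁) (W : Ω → τ₂) (Y : Ω → τ₃) (Z : Ω → τ₄)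
    (hU : ∀ ω ω', U ω' = U ω ↔ (Y ω' = Y ω ∧ Z ω' = Z ω))
    (hY : ∀ ω ω', Y ω' = Y ω → W ω' = W ω) (hZ : ∀ ω ω', Z ω' = Z ω → W ω' = W ω) :
    G p U + G p W ≤ G p Y + G p Z := by
  have key : ∑ ω, p ω * (Q p Y ω * Q p Z ω / (Q p U ω * Q p W ω)) ≤ 1 := by
    have e1 : ∀ ω, p ω * (Q p Y ω * Q p Z ω / (Q p U ω * Q p W ω)) =
        ∑ ω₁, ∑ ω₂, (if Y ω = Y ω₁ ∧ Z ω = Z ω₂ then p ω / Q p U ω else 0) *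
          (if W ω₂ = W ω₁ then p ω₁ * p ω₂ / Q p W ω₁ else 0) := by
      intro ω
      have : p ω * (Q p Y ω * Q p Z ω / (Q p U ω * Q p W ω)) =
        (Q p Y ω * Q p Z ω) * (p ω / Q p U ω / Q p W ω) := by
        simp only [div_eq_mul_inv, mul_inv]; ring
      rw [this]
      have q1 : Q p Y ω * Q p Z ω = (∑ ω' : Ω, if Y ω' = Y ω then p ω' else 0) *
        (∑ ω' : Ω, if Z ω' = Z ω then p ω' else 0) := rfl
      rw [q1, Finset.sum_mul_sum, Finset.sum_mul]
      refine Finset.sum_congr rfl fun ω₁ _ => ?_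
      rw [Finset.sum_mul]
      refine Finset.sum_congr rfl fun ω₂ _ => ?_
      by_cases h1 : Y ω₁ = Y ω
      · by_cases h2 : Z ω₂ = Z ω
        · have h3 : W ω₁ = W ω := hY _ _ h1
          have h4 : W ω₂ = W ω := hZ _ _ h2
          have h5 : Q p W ω₁ = Q p W ω := Q_congr_pt W h3
          simp only [h1, h2, h3, h4, h5, if_true, and_self]
          simp only [div_eq_mul_inv]; ring
        · simp [h1, h2, Ne.symm h2]
      · simp [h1, Ne.symm h1]
    simp_rw [e1]
    rw [Finset.sum_comm]
    have e2 : ∀ ω₁, ∑ ω, ∑ ω₂, (if Y ω = Y ω₁ ∧ Z ω = Z ω₂ then p ω / Q p U ω else 0) *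
          (if W ω₂ = W ω₁ then p ω₁ * p ω₂ / Q p W ω₁ else 0) ≤ p ω₁ := by
      intro ω₁
      rw [Finset.sum_comm]
      have e3 : ∀ ω₂, ∑ ω, (if Y ω = Y ω₁ ∧ Z ω = Z ω₂ then p ω / Q p U ω else 0) *
          (if W ω₂ = W ω₁ then p ω₁ * p ω₂ / Q p W ω₁ else 0) ≤
          (if W ω₂ = W ω₁ then p ω₁ * p ω₂ / Q p W ω₁ else 0) := by
        intro ω₂
        rw [← Finset.sum_mul]
        refine mul_le_of_le_one_left ?_ ?_
        · split_ifs
          · exact div_nonneg (mul_nonneg (hp0 _) (hp0 _)) (Q_nonneg hp0 _ _)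
          · exact le_rfl
        · by_cases hex : ∃ ω₀, Y ω₀ = Y ω₁ ∧ Z ω₀ = Z ω₂
          · obtain ⟨ω₀, h1, h2⟩ := hex
            have : ∀ ω, (if Y ω = Y ω₁ ∧ Z ω = Z ω₂ then p ω / Q p U ω else 0) =
                (if U ω = U ω₀ then p ω else 0) / Q p U ω₀ := by
              intro ω
              rw [← h1, ← h2]
              by_cases h : U ω = U ω₀
              · rw [if_pos ((hU _ _).1 h), if_pos h, Q_congr_pt U h]
              · rw [if_neg (fun h' => h ((hU _ _).2 h')), if_neg h, zero_div]
            simp_rw [this]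
            rw [← Finset.sum_div]
            exact div_self_le_one _
          · push Not at hex
            rw [Finset.sum_eq_zero]
            · exact zero_le_one
            · intro ω _
              rw [if_neg]
              rintro ⟨h1, h2⟩
              exact hex ω h1 h2
      refine (Finset.sum_le_sum fun ω₂ _ => e3 ω₂).trans ?_
      have : ∀ ω₂, (if W ω₂ = W ω₁ then p ω₁ * p ω₂ / Q p W ω₁ else 0) =
          p ω₁ * ((if W ω₂ = W ω₁ then p ω₂ else 0) / Q p W ω₁) := by
        intro ω₂; split_ifs
        · rw [mul_div_assoc]
        · simp
      simp_rw [this]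
      rw [← Finset.mul_sum, ← Finset.sum_div]
      exact mul_le_of_le_one_right (hp0 _) (div_self_le_one _)
    exact (Finset.sum_le_sum fun ω₁ _ => e2 ω₁).trans hp1.le
  have pt : ∀ ω, p ω - p ω * (Q p Y ω * Q p Z ω / (Q p U ω * Q p W ω)) ≤
      p ω * Real.log (Q p U ω) + p ω * Real.log (Q p W ω) - p ω * Real.log (Q p Y ω)
        - p ω * Real.log (Q p Z ω) := by
    intro ω
    rcases (hp0 ω).eq_or_lt with h0 | h0
    · simp [← h0]
    have a1 := Q_pos hp0 U h0
    have a2 := Q_pos hp0 W h0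
    have a3 := Q_pos hp0 Y h0
    have a4 := Q_pos hp0 Z h0
    have := Real.log_le_sub_one_of_pos (x := Q p Y ω * Q p Z ω / (Q p U ω * Q p W ω))
      (by positivity)
    rw [Real.log_div (by positivity) (by positivity), Real.log_mul a3.ne' a4.ne',
      Real.log_mul a1.ne' a2.ne'] at this
    have := mul_le_mul_of_nonneg_left this h0.le
    nlinarith [this]
  have := Finset.sum_le_sum fun ω (_ : ω ∈ Finset.univ) => pt ω
  simp only [Finset.sum_sub_distrib, Finset.sum_add_distrib] at this
  unfold G
  linarith

/-- The sub-family of `X` selected by the bit mask `m`. -/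
noncomputable def F {Ω V : Type*} (X : Fin 8 → Ω → V) (m : ℕ) (ω : Ω) : Fin 8 → Option V :=
  fun i => if m.testBit i then some (X i ω) else none

theorem F_eq {Ω V : Type*} (X : Fin 8 → Ω → V) (m : ℕ) (ω ω' : Ω) :
    F X m ω' = F X m ω ↔ ∀ i : Fin 8, m.testBit i → X i ω' = X i ω := by
  unfold F
  rw [funext_iff]
  refine forall_congr' fun i => ?_
  by_cases h : m.testBit i <;> simp [h]

theorem F_sub {Ω V : Type*} [Fintype Ω] {p : Ω → ℝ} (hp0 : ∀ ω, 0 ≤ p ω)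
    (hp1 : ∑ ω, p ω = 1) (X : Fin 8 → Ω → V) (a b : ℕ) :
    G p (F X (a ||| b)) + G p (F X (a &&& b)) ≤ G p (F X a) + G p (F X b) := by
  apply submod hp0 hp1
  · intro ω ω'
    simp only [F_eq, Nat.testBit_or, Bool.or_eq_true]
    constructor
    · intro h; exact ⟨fun i hi => h i (Or.inl hi), fun i hi => h i (Or.inr hi)⟩
    · rintro ⟨h1, h2⟩ i (hi | hi)
      exacts [h1 i hi, h2 i hi]
  · intro ω ω'
    simp only [F_eq, Nat.testBit_and, Bool.and_eq_true]
    exact fun h i hi => h i hi.1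
  · intro ω ω'
    simp only [F_eq, Nat.testBit_and, Bool.and_eq_true]
    exact fun h i hi => h i hi.2

theorem F_mono {Ω V : Type*} [Fintype Ω] {p : Ω → ℝ} (hp0 : ∀ ω, 0 ≤ p ω)
    (X : Fin 8 → Ω → V) (a b : ℕ) :
    G p (F X a) ≤ G p (F X (a ||| b)) := by
  apply G_mono hp0
  intro ω ω'
  simp only [F_eq, Nat.testBit_or, Bool.or_eq_true]
  exact fun h i hi => h i (Or.inl hi)

/-- The conditionally independent product of `p` with itself over `Z`. -/
noncomputable def cp {Ω τ : Type*} [Fintype Ω] (p : Ω → ℝ) (Z : Ω → τ) (w : Ω × Ω) : ℝ :=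
  if Z w.2 = Z w.1 then p w.1 * p w.2 / Q p Z w.1 else 0

theorem cp_nonneg {Ω τ : Type*} [Fintype Ω] {p : Ω → ℝ} (hp0 : ∀ ω, 0 ≤ p ω) (Z : Ω → τ)
    (w : Ω × Ω) : 0 ≤ cp p Z w := by
  unfold cp; split_ifs
  · exact div_nonneg (mul_nonneg (hp0 _) (hp0 _)) (Q_nonneg hp0 _ _)
  · exact le_rfl

theorem cp_fst {Ω τ : Type*} [Fintype Ω] {p : Ω → ℝ} (hp0 : ∀ ω, 0 ≤ p ω) (Z : Ω → τ)
    (ω₁ : Ω) : ∑ ω₂, cp p Z (ω₁, ω₂) = p ω₁ := by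
  have : ∀ ω₂, cp p Z (ω₁, ω₂) = p ω₁ * ((if Z ω₂ = Z ω₁ then p ω₂ else 0) / Q p Z ω₁) := by
    intro ω₂; unfold cp; split_ifs
    · simp [mul_div_assoc]
    · simp
  simp_rw [this]
  rw [← Finset.mul_sum, ← Finset.sum_div]
  rcases (hp0 ω₁).eq_or_lt with h0 | h0
  · simp [← h0]
  · have h := (Q_pos hp0 Z h0).ne'
    change p ω₁ * (Q p Z ω₁ / Q p Z ω₁) = p ω₁
    rw [div_self h, mul_one]

theorem cp_swap {Ω τ : Type*} [Fintype Ω] (p : Ω → ℝ) (Z : Ω → τ) (ω₁ ω₂ : Ω) :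
    cp p Z (ω₁, ω₂) = cp p Z (ω₂, ω₁) := by
  unfold cp
  by_cases h : Z ω₂ = Z ω₁
  · simp [h, Q_congr_pt Z h, mul_comm]
  · simp [h, Ne.symm h]

theorem cp_snd {Ω τ : Type*} [Fintype Ω] {p : Ω → ℝ} (hp0 : ∀ ω, 0 ≤ p ω) (Z : Ω → τ)
    (ω₂ : Ω) : ∑ ω₁, cp p Z (ω₁, ω₂) = p ω₂ := by
  simp_rw [fun ω₁ => cp_swap p Z ω₁ ω₂]
  exact cp_fst hp0 Z ω₂

theorem cp_sum {Ω τ : Type*} [Fintype Ω] {p : Ω → ℝ} (hp0 : ∀ ω, 0 ≤ p ω)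
    (hp1 : ∑ ω, p ω = 1) (Z : Ω → τ) : ∑ w, cp p Z w = 1 := by
  rw [Fintype.sum_prod_type]
  simp_rw [cp_fst hp0 Z, hp1]

theorem cp_sum_fst {Ω τ : Type*} [Fintype Ω] {p : Ω → ℝ} (hp0 : ∀ ω, 0 ≤ p ω) (Z : Ω → τ)
    (f : Ω → ℝ) : ∑ w : Ω × Ω, cp p Z w * f w.1 = ∑ ω, p ω * f ω := by
  rw [Fintype.sum_prod_type]
  simp_rw [← Finset.sum_mul, cp_fst hp0 Z]

theorem cp_sum_snd {Ω τ : Type*} [Fintype Ω] {p : Ω → ℝ} (hp0 : ∀ ω, 0 ≤ p ω) (Z : Ω → τ)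
    (f : Ω → ℝ) : ∑ w : Ω × Ω, cp p Z w * f w.2 = ∑ ω, p ω * f ω := by
  rw [Fintype.sum_prod_type, Finset.sum_comm]
  simp_rw [← Finset.sum_mul, cp_snd hp0 Z]

theorem G_fst {Ω τ τ' : Type*} [Fintype Ω] {p : Ω → ℝ} (hp0 : ∀ ω, 0 ≤ p ω) (Z : Ω → τ)
    (X : Ω → τ') : G (cp p Z) (fun w : Ω × Ω => X w.1) = G p X := by
  have h : ∀ w : Ω × Ω, Q (cp p Z) (fun w : Ω × Ω => X w.1) w = Q p X w.1 := by
    intro w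
    have := cp_sum_fst hp0 Z (fun ω => if X ω = X w.1 then 1 else 0)
    simpa [Q] using this
  unfold G
  simp_rw [h]
  rw [cp_sum_fst hp0 Z (fun ω => Real.log (Q p X ω))]

theorem G_snd {Ω τ τ' : Type*} [Fintype Ω] {p : Ω → ℝ} (hp0 : ∀ ω, 0 ≤ p ω) (Z : Ω → τ)
    (X : Ω → τ') : G (cp p Z) (fun w : Ω × Ω => X w.2) = G p X := by
  have h : ∀ w : Ω × Ω, Q (cp p Z) (fun w : Ω × Ω => X w.2) w = Q p X w.2 := by
    intro w
    have := cp_sum_snd hp0 Z (fun ω => if X ω = X w.2 then 1 else 0)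
    simpa [Q] using this
  unfold G
  simp_rw [h]
  rw [cp_sum_snd hp0 Z (fun ω => Real.log (Q p X ω))]

/-- Conditional independence in the product: `X` (a function of the first coordinate) and `Y`
(a function of the second coordinate), both refining `Z`. -/
theorem G_indep {Ω τ τ₁ τ₂ : Type*} [Fintype Ω] {p : Ω → ℝ} (hp0 : ∀ ω, 0 ≤ p ω)
    (Z : Ω → τ) (X : Ω → τ₁) (Y : Ω → τ₂)
    (hX : ∀ ω ω', X ω' = X ω → Z ω' = Z ω) (hY : ∀ ω ω', Y ω' = Y ω → Z ω' = Z ω) :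
    G (cp p Z) (fun w : Ω × Ω => (X w.1, Y w.2)) + G p Z = G p X + G p Y := by
  have hQ : ∀ w : Ω × Ω, cp p Z w ≠ 0 → Q (cp p Z) (fun w : Ω × Ω => (X w.1, Y w.2)) w =
      Q p X w.1 * Q p Y w.2 / Q p Z w.1 := by
    intro w hw
    have hz : Z w.2 = Z w.1 := by
      by_contra h
      exact hw (by simp [cp, h])
    unfold Q
    rw [Fintype.sum_prod_type, Finset.sum_mul_sum, Finset.sum_div]
    refine Finset.sum_congr rfl fun ω₁ _ => ?_
    rw [Finset.sum_div]
    refine Finset.sum_congr rfl fun ω₂ _ => ?_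
    by_cases h1 : X ω₁ = X w.1
    · by_cases h2 : Y ω₂ = Y w.2
      · have h3 := hX _ _ h1
        have h4 := hY _ _ h2
        have h5 : Z ω₂ = Z ω₁ := by rw [h3, h4, hz]
        simp only [h1, h2, if_true, cp, h5]
        rw [Q_congr_pt Z h3]
        rfl
      · simp [h2]
    · simp [h1]
  have e : ∀ w : Ω × Ω, cp p Z w * Real.log (Q (cp p Z) (fun w : Ω × Ω => (X w.1, Y w.2)) w) =
      cp p Z w * Real.log (Q p X w.1) + cp p Z w * Real.log (Q p Y w.2)
        - cp p Z w * Real.log (Q p Z w.1) := by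
    intro w
    by_cases hw : cp p Z w = 0
    · simp [hw]
    rw [hQ w hw]
    have h12 : p w.1 ≠ 0 ∧ p w.2 ≠ 0 := by
      constructor <;> intro h <;> exact hw (by simp [cp, h])
    have a1 := Q_pos hp0 X (lt_of_le_of_ne (hp0 _) h12.1.symm)
    have a2 := Q_pos hp0 Y (lt_of_le_of_ne (hp0 _) h12.2.symm)
    have a3 := Q_pos hp0 Z (lt_of_le_of_ne (hp0 _) h12.1.symm)
    rw [Real.log_div (mul_pos a1 a2).ne' a3.ne', Real.log_mul a1.ne' a2.ne']
    ring
  have c1 := cp_sum_fst hp0 Z (fun ω => Real.log (Q p X ω))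
  have c2 := cp_sum_snd hp0 Z (fun ω => Real.log (Q p Y ω))
  have c3 := cp_sum_fst hp0 Z (fun ω => Real.log (Q p Z ω))
  unfold G
  simp_rw [e]
  rw [Finset.sum_sub_distrib, Finset.sum_add_distrib, c1, c2, c3]
  ring

/-- Copy lemma: the variables with index in `new` become copies (via `σ`) of old variables over
the variables with index in `S`; all other variables are kept. -/
theorem copy_step {Ω : Type u} {V : Type v} [Fintype Ω] {p : Ω → ℝ} (hp0 : ∀ ω, 0 ≤ p ω)
    (hp1 : ∑ ω, p ω = 1) (X : Fin 8 → Ω → V) (new S : ℕ) (σ : Fin 8 → Fin 8)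
    (hS : ∀ i : Fin 8, S.testBit i → new.testBit i = false ∧ σ i = i) :
    ∃ (p' : Ω × Ω → ℝ) (X' : Fin 8 → Ω × Ω → V), (∀ ω, 0 ≤ p' ω) ∧ (∑ ω, p' ω = 1) ∧
      (∀ m : ℕ, (∀ i : Fin 8, m.testBit i → new.testBit i = false) →
        G p' (F X' m) = G p (F X m)) ∧
      (∀ m m' : ℕ, (∀ i : Fin 8, m.testBit i → (new ||| S).testBit i ∧ m'.testBit (σ i)) →
        (∀ i : Fin 8, m'.testBit i → ∃ j : Fin 8, m.testBit j ∧ σ j = i) →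
        G p' (F X' m) = G p (F X m')) ∧
      (∀ m₁ m₂ : ℕ, (∀ i : Fin 8, m₁.testBit i → new.testBit i = false) →
        (∀ i : Fin 8, m₂.testBit i → new.testBit i) →
        G p' (F X' (m₁ ||| m₂ ||| S)) + G p' (F X' S) =
          G p' (F X' (m₁ ||| S)) + G p' (F X' (m₂ ||| S))) := by
  set Z := F X S with hZ
  set X' : Fin 8 → Ω × Ω → V := fun i w => if new.testBit i then X (σ i) w.2 else X i w.1 with hX'
  have hsupp : ∀ w : Ω × Ω, cp p Z w ≠ 0 → ∀ i : Fin 8, S.testBit i → X i w.2 = X i w.1 := by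
    intro w hw
    have hz : Z w.2 = Z w.1 := by
      by_contra h
      exact hw (by simp [cp, h])
    rw [hZ, F_eq] at hz
    exact hz
  have hold : ∀ m : ℕ, (∀ i : Fin 8, m.testBit i → new.testBit i = false) →
        G (cp p Z) (F X' m) = G p (F X m) := by
    intro m hm
    rw [← G_fst hp0 Z (F X m)]
    apply G_congr
    intro w w' _ _
    simp only [F_eq]
    refine forall_congr' fun i => imp_congr_right fun hi => ?_
    simp [hX', hm i hi]
  have hnew : ∀ m : ℕ, (∀ i : Fin 8, m.testBit i → (new ||| S).testBit i) →
        G (cp p Z) (F X' m) = G p (F (fun i => X (σ i)) m) := by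
    intro m hm
    rw [← G_snd hp0 Z (F (fun i => X (σ i)) m)]
    apply G_congr
    intro w w' hw hw'
    simp only [F_eq]
    refine forall_congr' fun i => imp_congr_right fun hi => ?_
    by_cases hn : new.testBit i
    · simp [hX', hn]
    · have hs : S.testBit i := by
        have := hm i hi
        rw [Nat.testBit_or, Bool.or_eq_true] at this
        exact this.resolve_left hn
      have h2 := (hS i hs).2
      simp [hX', hn, h2, hsupp w hw i hs, hsupp w' hw' i hs]
  refine ⟨cp p Z, X', cp_nonneg hp0 Z, cp_sum hp0 hp1 Z, hold, ?_, ?_⟩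
  · intro m m' h1 h2
    rw [hnew m fun i hi => (h1 i hi).1]
    apply G_congr
    intro ω ω' _ _
    simp only [F_eq]
    constructor
    · intro h i hi
      obtain ⟨j, hj, rfl⟩ := h2 i hi
      exact h j hj
    · intro h i hi
      exact h (σ i) (h1 i hi).2
  · intro m₁ m₂ h1 h2
    have hSn : ∀ i : Fin 8, S.testBit i → new.testBit i = false := fun i hi => (hS i hi).1
    have hm1S : ∀ i : Fin 8, (m₁ ||| S).testBit i → new.testBit i = false := by
      intro i hi
      rw [Nat.testBit_or, Bool.or_eq_true] at hi
      exact hi.elim (h1 i) (hSn i)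
    have hm2S : ∀ i : Fin 8, (m₂ ||| S).testBit i → (new ||| S).testBit i := by
      intro i hi
      rw [Nat.testBit_or, Bool.or_eq_true] at hi ⊢
      exact hi.imp (h2 i) id
    rw [hold S hSn, hold _ hm1S, hnew _ hm2S]
    rw [← G_indep hp0 Z (F X (m₁ ||| S)) (F (fun i => X (σ i)) (m₂ ||| S))]
    · congr 1
      apply G_congr
      intro w w' hw hw'
      simp only [F_eq, Prod.mk.injEq]
      constructor
      · intro h
        constructor
        · intro i hi
          have := h i (by
            simp only [Nat.testBit_or, Bool.or_eq_true] at hi ⊢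
            tauto)
          simpa [hX', hm1S i hi] using this
        · intro i hi
          have h3 := h i (by
            simp only [Nat.testBit_or, Bool.or_eq_true] at hi ⊢
            tauto)
          by_cases hn : new.testBit i
          · simpa [hX', hn] using h3
          · have hs : S.testBit i := by
              have := hm2S i hi
              rw [Nat.testBit_or, Bool.or_eq_true] at this
              exact this.resolve_left hn
            rw [(hS i hs).2, hsupp w hw i hs, hsupp w' hw' i hs]
            simpa [hX', hn] using h3
      · rintro ⟨ha, hb⟩ i hi
        simp only [Nat.testBit_or, Bool.or_eq_true] at hi ha hb
        by_cases hn : new.testBit i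
        · have : m₂.testBit i := by
            rcases hi with (hi | hi) | hi
            · simp [h1 i hi] at hn
            · exact hi
            · simp [hSn i hi] at hn
          simpa [hX', hn] using hb i (Or.inl this)
        · have : m₁.testBit i ∨ S.testBit i := by
            rcases hi with (hi | hi) | hi
            · exact Or.inl hi
            · exact absurd (h2 i hi) hn
            · exact Or.inr hi
          simpa [hX', hn] using ha i this
    · intro ω ω'
      simp only [hZ, F_eq, Nat.testBit_or, Bool.or_eq_true]
      exact fun h i hi => h i (Or.inr hi)
    · intro ω ω'
      simp only [hZ, F_eq, Nat.testBit_or, Bool.or_eq_true]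
      intro h i hi
      have := h i (Or.inr hi)
      rwa [(hS i hi).2] at this

/-- The mask `m` avoids the mask `k`. -/
abbrev Av (m k : ℕ) : Prop := ∀ i : Fin 8, m.testBit i → k.testBit i = false

/-- `mm` is the image under `σ` of the mask `m`, which is contained in `k`. -/
abbrev Im1 (σ : Fin 8 → Fin 8) (k m mm : ℕ) : Prop :=
  ∀ i : Fin 8, m.testBit i → k.testBit i ∧ mm.testBit (σ i)

/-- Surjectivity part of the image condition. -/
abbrev Im2 (σ : Fin 8 → Fin 8) (m mm : ℕ) : Prop :=
  ∀ i : Fin 8, mm.testBit i → ∃ j : Fin 8, m.testBit j ∧ σ j = i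

set_option maxRecDepth 4000 in
set_option maxHeartbeats 4000000 in
/-- The linear-programming certificate. -/
theorem cert (H : ℕ → ℝ) (h0 : H 0 = 0) (hm : ∀ a b, H a ≤ H (a ||| b))
    (hs : ∀ a b, H (a ||| b) + H (a &&& b) ≤ H a + H b)
    (c1 : ∀ m m', Im1 ![0, 1, 2, 3, 0, 3, 6, 7] (48 ||| 6) m m' → Im2 ![0, 1, 2, 3, 0, 3, 6, 7] m m' →
      Av m 192 → Av m' 240 → H m = H m')
    (i1 : ∀ a b, Av a 240 → (∀ i : Fin 8, b.testBit i → Nat.testBit 48 i) →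
      H (a ||| b ||| 6) + H 6 = H (a ||| 6) + H (b ||| 6))
    (c2 : ∀ m m', Im1 ![0, 1, 2, 3, 4, 5, 2, 7] (64 ||| 35) m m' → Im2 ![0, 1, 2, 3, 4, 5, 2, 7] m m' →
      Av m 128 → Av m' 192 → H m = H m')
    (i2 : ∀ a b, Av a 192 → (∀ i : Fin 8, b.testBit i → Nat.testBit 64 i) →
      H (a ||| b ||| 35) + H 35 = H (a ||| 35) + H (b ||| 35))
    (c3 : ∀ m m', Im1 ![0, 1, 2, 3, 4, 5, 6, 0] (128 ||| 70) m m' → Im2 ![0, 1, 2, 3, 4, 5, 6, 0] m m' →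
      Av m 0 → Av m' 128 → H m = H m')
    (i3 : ∀ a b, Av a 128 → (∀ i : Fin 8, b.testBit i → Nat.testBit 128 i) →
      H (a ||| b ||| 70) + H 70 = H (a ||| 70) + H (b ||| 70))
    : 0 ≤ (-15) * H 1 + (-23) * H 2 + (19) * H 3 + (-3) * H 4 + (21) * H 5 + (29) * H 6 + (-31) * H
      7 + (3) * H 8 + (7) * H 9 + (19) * H 10 + (-7) * H 11 + (-19) * H 12 + (9) * H 13 + (-9) *
      H 14 + (3) * H 15 := by
  have s0 : H 15 + H 12 ≤ H 13 + H 14 := hs 13 14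
  have s1 : H 138 + H 2 ≤ H 10 + H 130 := hs 10 130
  have s2 : H 12 + H 0 ≤ H 4 + H 8 := hs 4 8
  have s3 : H 207 + H 75 ≤ H 79 + H 203 := hs 79 203
  have s4 : H 114 + H 96 ≤ H 98 + H 112 := hs 98 112
  have s5 : H 247 ≤ H 255 := hm 247 8
  have s6 : H 142 + H 12 ≤ H 14 + H 140 := hs 14 140
  have s7 : H 79 + H 13 ≤ H 15 + H 77 := hs 15 77
  have s8 : H 74 + H 2 ≤ H 10 + H 66 := hs 10 66
  have s9 : H 195 + H 66 ≤ H 67 + H 194 := hs 67 194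
  have s10 : H 35 + H 2 ≤ H 3 + H 34 := hs 3 34
  have s11 : H 135 + H 129 ≤ H 131 + H 133 := hs 131 133
  have s12 : H 139 + H 136 ≤ H 137 + H 138 := hs 137 138
  have s13 : H 247 + H 214 ≤ H 215 + H 246 := hs 215 246
  have s14 : H 84 + H 4 ≤ H 20 + H 68 := hs 20 68
  have s15 : H 107 + H 11 ≤ H 43 + H 75 := hs 43 75
  have s16 : H 239 ≤ H 255 := hm 239 16
  have s17 : H 77 + H 12 ≤ H 13 + H 76 := hs 13 76
  have s18 : H 112 + H 16 ≤ H 48 + H 80 := hs 48 80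
  have s19 : H 119 + H 23 ≤ H 55 + H 87 := hs 55 87
  have s20 : H 196 + H 128 ≤ H 132 + H 192 := hs 132 192
  have s21 : H 14 + H 2 ≤ H 6 + H 10 := hs 6 10
  have s22 : H 103 + H 67 ≤ H 71 + H 99 := hs 71 99
  have s23 : H 86 + H 80 ≤ H 82 + H 84 := hs 82 84
  have s24 : H 199 + H 133 ≤ H 135 + H 197 := hs 135 197
  have s25 : H 118 + H 50 ≤ H 54 + H 114 := hs 54 114
  have s26 : H 71 + H 68 ≤ H 69 + H 70 := hs 69 70
  have s27 : H 215 + H 198 ≤ H 199 + H 214 := hs 199 214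
  have s28 : H 73 + H 1 ≤ H 9 + H 65 := hs 9 65
  have s29 : H 197 + H 68 ≤ H 69 + H 196 := hs 69 196
  have s30 : H 75 + H 72 ≤ H 73 + H 74 := hs 73 74
  have s31 : H 140 + H 128 ≤ H 132 + H 136 := hs 132 136
  have s32 : H 206 + H 14 ≤ H 78 + H 142 := hs 78 142
  have s33 : H 82 + H 2 ≤ H 18 + H 66 := hs 18 66
  have s34 : H 203 + H 131 ≤ H 139 + H 195 := hs 139 195
  have s35 : H 111 + H 15 ≤ H 47 + H 79 := hs 47 79
  have s36 : H 76 + H 64 ≤ H 68 + H 72 := hs 68 72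
  have s37 : H 137 + H 1 ≤ H 9 + H 129 := hs 9 129
  have e0 : H 255 + H 70 = H 127 + H 198 := i3 57 128 (by decide) (by decide)
  have e1 : H 247 + H 70 = H 119 + H 198 := i3 49 128 (by decide) (by decide)
  have e2 : H 246 + H 70 = H 118 + H 198 := i3 48 128 (by decide) (by decide)
  have e3 : H 239 + H 70 = H 111 + H 198 := i3 41 128 (by decide) (by decide)
  have e4 : H 215 + H 70 = H 87 + H 198 := i3 17 128 (by decide) (by decide)
  have e5 : H 214 + H 70 = H 86 + H 198 := i3 16 128 (by decide) (by decide)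
  have e6 : H 207 + H 70 = H 79 + H 198 := i3 9 128 (by decide) (by decide)
  have e7 : H 206 + H 70 = H 78 + H 198 := i3 8 128 (by decide) (by decide)
  have e8 : H 199 + H 70 = H 71 + H 198 := i3 1 128 (by decide) (by decide)
  have e9 : H 198 = H 71 := c3 198 71 (by decide) (by decide) (by decide) (by decide)
  have e10 : H 196 = H 69 := c3 196 69 (by decide) (by decide) (by decide) (by decide)
  have e11 : H 194 = H 67 := c3 194 67 (by decide) (by decide) (by decide) (by decide)
  have e12 : H 192 = H 65 := c3 192 65 (by decide) (by decide) (by decide) (by decide)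
  have e13 : H 132 = H 5 := c3 132 5 (by decide) (by decide) (by decide) (by decide)
  have e14 : H 130 = H 3 := c3 130 3 (by decide) (by decide) (by decide) (by decide)
  have e15 : H 128 = H 1 := c3 128 1 (by decide) (by decide) (by decide) (by decide)
  have e16 : H 127 + H 35 = H 63 + H 99 := i2 28 64 (by decide) (by decide)
  have e17 : H 119 + H 35 = H 55 + H 99 := i2 20 64 (by decide) (by decide)
  have e18 : H 111 + H 35 = H 47 + H 99 := i2 12 64 (by decide) (by decide)
  have e19 : H 107 + H 35 = H 43 + H 99 := i2 8 64 (by decide) (by decide)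
  have e20 : H 103 + H 35 = H 39 + H 99 := i2 4 64 (by decide) (by decide)
  have e21 : H 99 = H 39 := c2 99 39 (by decide) (by decide) (by decide) (by decide)
  have e22 : H 98 = H 38 := c2 98 38 (by decide) (by decide) (by decide) (by decide)
  have e23 : H 96 = H 36 := c2 96 36 (by decide) (by decide) (by decide) (by decide)
  have e24 : H 67 = H 7 := c2 67 7 (by decide) (by decide) (by decide) (by decide)
  have e25 : H 66 = H 6 := c2 66 6 (by decide) (by decide) (by decide) (by decide)
  have e26 : H 65 = H 5 := c2 65 5 (by decide) (by decide) (by decide) (by decide)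
  have e27 : H 64 = H 4 := c2 64 4 (by decide) (by decide) (by decide) (by decide)
  have e28 : H 63 + H 6 = H 15 + H 54 := i1 9 48 (by decide) (by decide)
  have e29 : H 55 + H 6 = H 7 + H 54 := i1 1 48 (by decide) (by decide)
  have e30 : H 54 = H 15 := c1 54 15 (by decide) (by decide) (by decide) (by decide)
  have e31 : H 50 = H 11 := c1 50 11 (by decide) (by decide) (by decide) (by decide)
  have e32 : H 48 = H 9 := c1 48 9 (by decide) (by decide) (by decide) (by decide)
  have e33 : H 47 + H 6 = H 15 + H 38 := i1 9 32 (by decide) (by decide)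
  have e34 : H 39 + H 6 = H 7 + H 38 := i1 1 32 (by decide) (by decide)
  have e35 : H 38 = H 14 := c1 38 14 (by decide) (by decide) (by decide) (by decide)
  have e36 : H 36 = H 12 := c1 36 12 (by decide) (by decide) (by decide) (by decide)
  have e37 : H 34 = H 10 := c1 34 10 (by decide) (by decide) (by decide) (by decide)
  have e38 : H 23 + H 6 = H 7 + H 22 := i1 1 16 (by decide) (by decide)
  have e39 : H 22 = H 7 := c1 22 7 (by decide) (by decide) (by decide) (by decide)
  have e40 : H 20 = H 5 := c1 20 5 (by decide) (by decide) (by decide) (by decide)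
  have e41 : H 18 = H 3 := c1 18 3 (by decide) (by decide) (by decide) (by decide)
  have e42 : H 16 = H 1 := c1 16 1 (by decide) (by decide) (by decide) (by decide)
  linear_combination 9 * s0 + s1 + 3 * s2 + s3 + 4 * s4 + 6 * s5 + s6 + 2 * s7 + 2 * s8 + s9 + 14 * s10 + s11 +
    s12 + 4 * s13 + 4 * s14 + 3 * s15 + 6 * s16 + 2 * s17 + 4 * s18 + 4 * s19 + 7 * s20 + 2 *
    s21 + s22 + 4 * s23 + s24 + 4 * s25 + 5 * s26 + 8 * s27 + 2 * s28 + s29 + 2 * s30 + s31 +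
    s32 + 4 * s33 + s34 + 2 * s35 + 2 * s36 + s37 + (12) * e0 + (-10) * e1 + (4) * e2 + (-6) *
    e3 + (-4) * e4 + (4) * e5 + (-1) * e6 + (-1) * e7 + (7) * e8 + (-3) * e9 + (-6) * e10 +
    (1) * e11 + (7) * e12 + (8) * e13 + (1) * e14 + (-8) * e15 + (12) * e16 + (-14) * e17 +
    (-8) * e18 + (-3) * e19 + (-1) * e20 + (-13) * e21 + (4) * e22 + (-4) * e23 + (1) * e24 +
    (5) * e25 + (9) * e26 + (-2) * e27 + (12) * e28 + (-10) * e29 + (6) * e30 + (-4) * e31 +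
    (4) * e32 + (-6) * e33 + (-14) * e34 + (-16) * e35 + (-4) * e36 + (14) * e37 + (-4) * e38
    + (-4) * e39 + (4) * e40 + (4) * e41 + (-4) * e42 + (-3) * h0

theorem G_F_zero {Ω V : Type*} [Fintype Ω] {p : Ω → ℝ} (hp1 : ∑ ω, p ω = 1)
    (X : Fin 8 → Ω → V) : G p (F X 0) = 0 := by
  have h : ∀ ω, Q p (F X 0) ω = 1 := by
    intro ω
    rw [← hp1]
    refine Finset.sum_congr rfl fun ω' _ => ?_
    rw [if_pos]
    rw [F_eq]
    simp
  simp [G, h]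

theorem key {Ω : Type u} {V : Type v} [Fintype Ω] {p : Ω → ℝ} (hp0 : ∀ ω, 0 ≤ p ω)
    (hp1 : ∑ ω, p ω = 1) (X : Fin 8 → Ω → V) (H₀ : ℕ → ℝ) (hH : ∀ m, H₀ m = G p (F X m)) :
    0 ≤ (-15) * H₀ 1 + (-23) * H₀ 2 + (19) * H₀ 3 + (-3) * H₀ 4 + (21) * H₀ 5 + (29) * H₀ 6 +
      (-31) * H₀ 7 + (3) * H₀ 8 + (7) * H₀ 9 + (19) * H₀ 10 + (-7) * H₀ 11 + (-19) * H₀ 12 + (9)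
      * H₀ 13 + (-9) * H₀ 14 + (3) * H₀ 15 := by
  obtain ⟨p1, X1, pos1, sum1, old1, cop1, ind1⟩ :=
    copy_step hp0 hp1 X 48 6 ![0, 1, 2, 3, 0, 3, 6, 7] (by decide)
  obtain ⟨p2, X2, pos2, sum2, old2, cop2, ind2⟩ :=
    copy_step pos1 sum1 X1 64 35 ![0, 1, 2, 3, 4, 5, 2, 7] (by decide)
  obtain ⟨p3, X3, pos3, sum3, old3, cop3, ind3⟩ :=
    copy_step pos2 sum2 X2 128 70 ![0, 1, 2, 3, 4, 5, 6, 0] (by decide)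
  have av : ∀ m k k' : ℕ, k' &&& k = k' → Av m k → Av m k' := by
    intro m k k' hk h i hi
    have := h i hi
    rw [← hk, Nat.testBit_and, this, Bool.and_false]
  have avor : ∀ a b k : ℕ, Av a k → Av b k → Av (a ||| b) k := by
    intro a b k h1 h2 i hi
    rw [Nat.testBit_or, Bool.or_eq_true] at hi
    exact hi.elim (h1 i) (h2 i)
  have t2 : ∀ m, Av m 128 → G p3 (F X3 m) = G p2 (F X2 m) := old3
  have t1 : ∀ m, Av m 192 → G p3 (F X3 m) = G p1 (F X1 m) := fun m h =>
    (t2 m (av m 192 128 rfl h)).trans (old2 m (av m 192 64 rfl h))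
  have t0 : ∀ m, Av m 240 → G p3 (F X3 m) = G p (F X m) := fun m h =>
    (t1 m (av m 240 192 rfl h)).trans (old1 m (av m 240 48 rfl h))
  have bsub : ∀ b new k : ℕ, (∀ i : Fin 8, b.testBit i → new.testBit i) → Av new k →
      Av b k := fun b new k h1 h2 i hi => h2 i (h1 i hi)
  have := cert (fun m => G p3 (F X3 m)) (G_F_zero sum3 X3) (F_mono pos3 X3)
    (F_sub pos3 sum3 X3) ?_ ?_ ?_ ?_ ?_ ?_
  · simp only [hH]
    rw [t0 1 (by decide), t0 2 (by decide), t0 3 (by decide), t0 4 (by decide), t0 5 (by decide), t0 6 (by decide), t0 7 (by decide), t0 8 (by decide), t0 9 (by decide), t0 10 (by decide), t0 11 (by decide), t0 12 (by decide), t0 13 (by decide), t0 14 (by decide), t0 15 (by decide)] at this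
    exact this
  · intro m m' h1 h2 h3 h4
    exact (t1 m h3).trans ((cop1 m m' h1 h2).trans (t0 m' h4).symm)
  · intro a b h1 h2
    have hb := bsub b 48 192 h2 (by decide)
    have ha := av a 240 192 rfl h1
    have hS : Av 6 192 := by decide
    change G p3 (F X3 (a ||| b ||| 6)) + G p3 (F X3 6) =
      G p3 (F X3 (a ||| 6)) + G p3 (F X3 (b ||| 6))
    rw [t1 _ (avor _ _ _ (avor _ _ _ ha hb) hS), t1 _ hS, t1 _ (avor _ _ _ ha hS),
      t1 _ (avor _ _ _ hb hS)]
    exact ind1 a b (av a 240 48 rfl h1) h2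
  · intro m m' h1 h2 h3 h4
    exact (t2 m h3).trans ((cop2 m m' h1 h2).trans (t1 m' h4).symm)
  · intro a b h1 h2
    have hb := bsub b 64 128 h2 (by decide)
    have ha := av a 192 128 rfl h1
    have hS : Av 35 128 := by decide
    change G p3 (F X3 (a ||| b ||| 35)) + G p3 (F X3 35) =
      G p3 (F X3 (a ||| 35)) + G p3 (F X3 (b ||| 35))
    rw [t2 _ (avor _ _ _ (avor _ _ _ ha hb) hS), t2 _ hS, t2 _ (avor _ _ _ ha hS),
      t2 _ (avor _ _ _ hb hS)]
    exact ind2 a b (av a 192 64 rfl h1) h2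
  · intro m m' h1 h2 h3 h4
    exact (cop3 m m' h1 h2).trans (t2 m' h4).symm
  · intro a b h1 h2
    exact ind3 a b h1 h2

theorem ent_eq_GF {Ω V α : Type*} [Fintype Ω] [Fintype α] (p : Ω → ℝ) (Y : Ω → α)
    (X : Fin 8 → Ω → V) (m : ℕ)
    (h : ∀ ω ω', Y ω' = Y ω ↔ ∀ i : Fin 8, m.testBit i → X i ω' = X i ω) :
    G p (F X m) = ent p Y := by
  rw [ent_eq_G]
  apply G_congr
  intro ω ω' _ _
  rw [F_eq, h]

theorem ent_perm {Ω α β : Type*} [Fintype Ω] [Fintype α] [Fintype β] (p : Ω → ℝ) (Y : Ω → α)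
    (Z : Ω → β) (h : ∀ ω ω', Y ω' = Y ω ↔ Z ω' = Z ω) : ent p Y = ent p Z := by
  rw [ent_eq_G, ent_eq_G]
  exact G_congr _ _ fun ω ω' _ _ => h ω ω'

theorem key_ent {Ω α β γ δ : Type*} [Fintype Ω] [Fintype α] [Fintype β] [Fintype γ] [Fintype δ]
    (p : Ω → ℝ) (hp0 : ∀ ω, 0 ≤ p ω) (hp1 : ∑ ω, p ω = 1)
    (A : Ω → α) (B : Ω → β) (C : Ω → γ) (D : Ω → δ) :
    0 ≤ (-15) * ent p A +
      (-23) * ent p B +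
      (19) * ent p (fun ω => (A ω, B ω)) +
      (-3) * ent p C +
      (21) * ent p (fun ω => (A ω, C ω)) +
      (29) * ent p (fun ω => (B ω, C ω)) +
      (-31) * ent p (fun ω => (A ω, B ω, C ω)) +
      (3) * ent p D +
      (7) * ent p (fun ω => (A ω, D ω)) +
      (19) * ent p (fun ω => (B ω, D ω)) +
      (-7) * ent p (fun ω => (A ω, B ω, D ω)) +
      (-19) * ent p (fun ω => (C ω, D ω)) +
      (9) * ent p (fun ω => (A ω, C ω, D ω)) +
      (-9) * ent p (fun ω => (B ω, C ω, D ω)) +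
      (3) * ent p (fun ω => (A ω, B ω, C ω, D ω)) := by
  let X : Fin 8 → Ω → (α ⊕ β ⊕ γ ⊕ δ) :=
    ![fun ω => Sum.inl (A ω), fun ω => Sum.inr (Sum.inl (B ω)),
      fun ω => Sum.inr (Sum.inr (Sum.inl (C ω))), fun ω => Sum.inr (Sum.inr (Sum.inr (D ω))),
      fun ω => Sum.inl (A ω), fun ω => Sum.inl (A ω), fun ω => Sum.inl (A ω),
      fun ω => Sum.inl (A ω)]
  have h := key hp0 hp1 X (fun m => G p (F X m)) (fun _ => rfl)
  have h1 : G p (F X 1) = ent p A := ent_eq_GF p _ X 1 (by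
    intro ω ω'; simp [Fin.forall_fin_succ, X, Nat.testBit])
  have h2 : G p (F X 2) = ent p B := ent_eq_GF p _ X 2 (by
    intro ω ω'; simp [Fin.forall_fin_succ, X, Nat.testBit])
  have h3 : G p (F X 3) = ent p (fun ω => (A ω, B ω)) := ent_eq_GF p _ X 3 (by
    intro ω ω'; simp [Fin.forall_fin_succ, X, Nat.testBit])
  have h4 : G p (F X 4) = ent p C := ent_eq_GF p _ X 4 (by
    intro ω ω'; simp [Fin.forall_fin_succ, X, Nat.testBit])
  have h5 : G p (F X 5) = ent p (fun ω => (A ω, C ω)) := ent_eq_GF p _ X 5 (by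
    intro ω ω'; simp [Fin.forall_fin_succ, X, Nat.testBit])
  have h6 : G p (F X 6) = ent p (fun ω => (B ω, C ω)) := ent_eq_GF p _ X 6 (by
    intro ω ω'; simp [Fin.forall_fin_succ, X, Nat.testBit])
  have h7 : G p (F X 7) = ent p (fun ω => (A ω, B ω, C ω)) := ent_eq_GF p _ X 7 (by
    intro ω ω'; simp [Fin.forall_fin_succ, X, Nat.testBit])
  have h8 : G p (F X 8) = ent p D := ent_eq_GF p _ X 8 (by
    intro ω ω'; simp [Fin.forall_fin_succ, X, Nat.testBit])
  have h9 : G p (F X 9) = ent p (fun ω => (A ω, D ω)) := ent_eq_GF p _ X 9 (by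
    intro ω ω'; simp [Fin.forall_fin_succ, X, Nat.testBit])
  have h10 : G p (F X 10) = ent p (fun ω => (B ω, D ω)) := ent_eq_GF p _ X 10 (by
    intro ω ω'; simp [Fin.forall_fin_succ, X, Nat.testBit])
  have h11 : G p (F X 11) = ent p (fun ω => (A ω, B ω, D ω)) := ent_eq_GF p _ X 11 (by
    intro ω ω'; simp [Fin.forall_fin_succ, X, Nat.testBit])
  have h12 : G p (F X 12) = ent p (fun ω => (C ω, D ω)) := ent_eq_GF p _ X 12 (by
    intro ω ω'; simp [Fin.forall_fin_succ, X, Nat.testBit])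
  have h13 : G p (F X 13) = ent p (fun ω => (A ω, C ω, D ω)) := ent_eq_GF p _ X 13 (by
    intro ω ω'; simp [Fin.forall_fin_succ, X, Nat.testBit])
  have h14 : G p (F X 14) = ent p (fun ω => (B ω, C ω, D ω)) := ent_eq_GF p _ X 14 (by
    intro ω ω'; simp [Fin.forall_fin_succ, X, Nat.testBit])
  have h15 : G p (F X 15) = ent p (fun ω => (A ω, B ω, C ω, D ω)) := ent_eq_GF p _ X 15 (by
    intro ω ω'; simp [Fin.forall_fin_succ, X, Nat.testBit])
  simp only [h1, h2, h3, h4, h5, h6, h7, h8, h9, h10, h11, h12, h13, h14, h15] at h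
  exact h

end Ingl

/-- For every quadruple of jointly distributed random variables `(A,B,C,D)` taking finitely
many values, with `H(A,B,C,D) > 0`, the Ingleton score satisfies
`Ing(A,B,C,D)/H(A,B,C,D) ≥ −3/19`; equivalently
`I(A;B|C) + I(A;B|D) + I(C;D) − I(A;B) + (3/19)·H(A,B,C,D) ≥ 0`. -/
theorem ingleton_score_bound
    {Ω α β γ δ : Type*} [Fintype Ω] [Fintype α] [Fintype β] [Fintype γ] [Fintype δ]
    (p : Ω → ℝ) (hp0 : ∀ ω, 0 ≤ p ω) (hp1 : ∑ ω, p ω = 1)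
    (A : Ω → α) (B : Ω → β) (C : Ω → γ) (D : Ω → δ)
    (hpos : 0 < ent p (fun ω => (A ω, B ω, C ω, D ω))) :
    ((ent p (fun ω => (A ω, C ω)) + ent p (fun ω => (B ω, C ω))
        - ent p (fun ω => (A ω, B ω, C ω)) - ent p C)
      + (ent p (fun ω => (A ω, D ω)) + ent p (fun ω => (B ω, D ω))
        - ent p (fun ω => (A ω, B ω, D ω)) - ent p D)
      + (ent p C + ent p D - ent p (fun ω => (C ω, D ω)))
      - (ent p A + ent p B - ent p (fun ω => (A ω, B ω))))
        / ent p (fun ω => (A ω, B ω, C ω, D ω)) ≥ -(3 / 19)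
    ∧
    ((ent p (fun ω => (A ω, C ω)) + ent p (fun ω => (B ω, C ω))
        - ent p (fun ω => (A ω, B ω, C ω)) - ent p C)
      + (ent p (fun ω => (A ω, D ω)) + ent p (fun ω => (B ω, D ω))
        - ent p (fun ω => (A ω, B ω, D ω)) - ent p D)
      + (ent p C + ent p D - ent p (fun ω => (C ω, D ω)))
      - (ent p A + ent p B - ent p (fun ω => (A ω, B ω)))
      + (3 / 19) * ent p (fun ω => (A ω, B ω, C ω, D ω)) ≥ 0) := by
  have k1 := Ingl.key_ent p hp0 hp1 A B C D
  have k2 := Ingl.key_ent p hp0 hp1 B A C D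
  have k3 := Ingl.key_ent p hp0 hp1 A B D C
  have k4 := Ingl.key_ent p hp0 hp1 B A D C
  have qBA : ent p (fun ω => (B ω, A ω)) = ent p (fun ω => (A ω, B ω)) :=
    Ingl.ent_perm p _ _ (fun ω ω' => by simp only [Prod.mk.injEq]; tauto)
  have qBAC : ent p (fun ω => (B ω, A ω, C ω)) = ent p (fun ω => (A ω, B ω, C ω)) :=
    Ingl.ent_perm p _ _ (fun ω ω' => by simp only [Prod.mk.injEq]; tauto)
  have qBAD : ent p (fun ω => (B ω, A ω, D ω)) = ent p (fun ω => (A ω, B ω, D ω)) :=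
    Ingl.ent_perm p _ _ (fun ω ω' => by simp only [Prod.mk.injEq]; tauto)
  have qBACD : ent p (fun ω => (B ω, A ω, C ω, D ω)) = ent p (fun ω => (A ω, B ω, C ω, D ω)) :=
    Ingl.ent_perm p _ _ (fun ω ω' => by simp only [Prod.mk.injEq]; tauto)
  have qDC : ent p (fun ω => (D ω, C ω)) = ent p (fun ω => (C ω, D ω)) :=
    Ingl.ent_perm p _ _ (fun ω ω' => by simp only [Prod.mk.injEq]; tauto)
  have qADC : ent p (fun ω => (A ω, D ω, C ω)) = ent p (fun ω => (A ω, C ω, D ω)) :=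
    Ingl.ent_perm p _ _ (fun ω ω' => by simp only [Prod.mk.injEq]; tauto)
  have qBDC : ent p (fun ω => (B ω, D ω, C ω)) = ent p (fun ω => (B ω, C ω, D ω)) :=
    Ingl.ent_perm p _ _ (fun ω ω' => by simp only [Prod.mk.injEq]; tauto)
  have qABDC : ent p (fun ω => (A ω, B ω, D ω, C ω)) = ent p (fun ω => (A ω, B ω, C ω, D ω)) :=
    Ingl.ent_perm p _ _ (fun ω ω' => by simp only [Prod.mk.injEq]; tauto)
  have qBADC : ent p (fun ω => (B ω, A ω, D ω, C ω)) = ent p (fun ω => (A ω, B ω, C ω, D ω)) :=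
    Ingl.ent_perm p _ _ (fun ω ω' => by simp only [Prod.mk.injEq]; tauto)
  simp only [qBA, qBAC, qBAD, qBACD, qDC, qADC, qBDC, qABDC, qBADC] at k2 k3 k4
  have main : (ent p (fun ω => (A ω, C ω)) + ent p (fun ω => (B ω, C ω))
        - ent p (fun ω => (A ω, B ω, C ω)) - ent p C)
      + (ent p (fun ω => (A ω, D ω)) + ent p (fun ω => (B ω, D ω))
        - ent p (fun ω => (A ω, B ω, D ω)) - ent p D)
      + (ent p C + ent p D - ent p (fun ω => (C ω, D ω)))
      - (ent p A + ent p B - ent p (fun ω => (A ω, B ω)))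
      + (3 / 19) * ent p (fun ω => (A ω, B ω, C ω, D ω)) ≥ 0 := by
    linarith
  refine ⟨?_, main⟩
  rw [ge_iff_le, le_div_iff₀ hpos]
  linarith
end

section
/- Let S_0, S_1, …, S_7 be jointly distributed random variables taking finitely many values, with H(S_0) > 0, such that: (i) H(S_0 | S_V) = 0 for every minimal qualified set V of the access structure V_0, and (ii) H(S_0 | S_V) = H(S_0) for every V ⊆ {1,…,7} that includes no minimal qualified set. Then max{H(S_1),…,H(S_7)} / H(S_0) ≥ 561/491. -/
open scoped Classical

/-- Entropy `H(S_V)` of the subtuple `(S_i)_{i ∈ V}` of a family of jointly distributed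
random variables `S`. -/
noncomputable def entS {Ω : Type*} [Fintype Ω] {n : ℕ} {α : Fin n → Type*}
    [∀ i, Fintype (α i)] (p : Ω → ℝ) (S : (i : Fin n) → Ω → α i) (V : Finset (Fin n)) : ℝ :=
  ent p (fun ω => fun i : V => S i ω)

/-- The minimal qualified sets of the access structure `V₀` on the Vámos matroid, with
parties `{1,…,7}` (index `0` is reserved for the secret): the 3-sets `{1,2,3}` and `{1,4,5}`,
together with all 4-subsets of `{1,…,7}` containing neither of them, except
`{2,3,4,5}`, `{2,3,6,7}`, `{4,5,6,7}`. -/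
def MinQual (V : Finset (Fin 8)) : Prop :=
  V = {1, 2, 3} ∨ V = {1, 4, 5} ∨
    (V.card = 4 ∧ V ⊆ ({1, 2, 3, 4, 5, 6, 7} : Finset (Fin 8)) ∧
      ¬ ({1, 2, 3} : Finset (Fin 8)) ⊆ V ∧ ¬ ({1, 4, 5} : Finset (Fin 8)) ⊆ V ∧
      V ≠ {2, 3, 4, 5} ∧ V ≠ {2, 3, 6, 7} ∧ V ≠ {4, 5, 6, 7})

/-! ### Entropy as an expectation -/

/-- Probability of the fibre of `X` through `ω`. -/
noncomputable def fib {Ω α : Type*} [Fintype Ω] (p : Ω → ℝ) (X : Ω → α) (ω : Ω) : ℝ :=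
  ∑ ω' : Ω, if X ω' = X ω then p ω' else 0

theorem ent_eq {Ω α : Type*} [Fintype Ω] [Fintype α] (p : Ω → ℝ) (X : Ω → α) :
    ent p X = ∑ ω, p ω * (-Real.log (fib p X ω)) := by
  unfold ent fib
  have key : ∀ a : α, Real.negMulLog (∑ ω : Ω, if X ω = a then p ω else 0)
      = ∑ ω : Ω, if X ω = a then
          p ω * (-Real.log (∑ ω' : Ω, if X ω' = X ω then p ω' else 0)) else 0 := by
    intro a
    rw [Real.negMulLog, neg_mul, ← mul_neg, Finset.sum_mul]
    refine Finset.sum_congr rfl fun ω _ => ?_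
    by_cases h : X ω = a
    · subst h; simp
    · simp [h]
  rw [Finset.sum_congr rfl fun a _ => key a, Finset.sum_comm]
  refine Finset.sum_congr rfl fun ω _ => ?_
  simp

section basic
variable {Ω α β γ δ : Type*} [Fintype Ω]

theorem fib_nonneg (p : Ω → ℝ) (hp : ∀ ω, 0 ≤ p ω) (X : Ω → α) (ω : Ω) : 0 ≤ fib p X ω :=
  Finset.sum_nonneg fun ω' _ => by split_ifs <;> simp [hp]

theorem le_fib (p : Ω → ℝ) (hp : ∀ ω, 0 ≤ p ω) (X : Ω → α) (ω : Ω) : p ω ≤ fib p X ω := by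
  have := Finset.single_le_sum (f := fun ω' => if X ω' = X ω then p ω' else 0)
    (fun ω' _ => by split_ifs <;> simp [hp]) (Finset.mem_univ ω)
  simpa [fib] using this

theorem fib_pos (p : Ω → ℝ) (hp : ∀ ω, 0 ≤ p ω) (X : Ω → α) (ω : Ω) (h : 0 < p ω) :
    0 < fib p X ω := h.trans_le (le_fib p hp X ω)

theorem ent_congr [Fintype α] [Fintype β] (p : Ω → ℝ) (hp : ∀ ω, 0 ≤ p ω)
    (X : Ω → α) (Y : Ω → β)
    (h : ∀ ω ω', 0 < p ω → 0 < p ω' → (X ω = X ω' ↔ Y ω = Y ω')) : ent p X = ent p Y := by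
  rw [ent_eq, ent_eq]
  refine Finset.sum_congr rfl fun ω _ => ?_
  rcases (hp ω).eq_or_lt with h0 | h0
  · simp [← h0]
  · congr 3
    refine Finset.sum_congr rfl fun ω' _ => ?_
    rcases (hp ω').eq_or_lt with h1 | h1
    · simp [← h1]
    · simp only [h ω' ω h1 h0]

theorem ent_mono [Fintype α] [Fintype β] (p : Ω → ℝ) (hp : ∀ ω, 0 ≤ p ω)
    (X : Ω → α) (Y : Ω → β) (h : ∀ ω ω', Y ω = Y ω' → X ω = X ω') : ent p X ≤ ent p Y := by
  rw [ent_eq, ent_eq]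
  refine Finset.sum_le_sum fun ω _ => ?_
  rcases (hp ω).eq_or_lt with h0 | h0
  · simp [← h0]
  · refine mul_le_mul_of_nonneg_left (neg_le_neg ?_) (hp ω)
    refine Real.log_le_log (fib_pos p hp Y ω h0) ?_
    refine Finset.sum_le_sum fun ω' _ => ?_
    by_cases hy : Y ω' = Y ω
    · simp [hy, h _ _ hy]
    · simp only [hy, if_false]; split_ifs <;> simp [hp]

theorem ent_const [Fintype α] (p : Ω → ℝ) (hp1 : ∑ ω, p ω = 1)
    (X : Ω → α) (h : ∀ ω ω', X ω = X ω') : ent p X = 0 := by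
  rw [ent_eq]
  refine Finset.sum_eq_zero fun ω _ => ?_
  have : fib p X ω = 1 := by
    rw [← hp1]
    exact Finset.sum_congr rfl fun ω' _ => by simp [h ω' ω]
  simp [this]

theorem fib_eq_of_eq (p : Ω → ℝ) (X : Ω → α) {ω ω' : Ω} (h : X ω = X ω') :
    fib p X ω = fib p X ω' := by unfold fib; rw [h]

/-- The counting inequality behind submodularity. -/
theorem ratio_sum_le (p : Ω → ℝ) (hp : ∀ ω, 0 ≤ p ω)
    (X : Ω → α) (Y : Ω → β) (U : Ω → γ) (I : Ω → δ)
    (hU : ∀ ω ω', U ω = U ω' ↔ X ω = X ω' ∧ Y ω = Y ω')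
    (hX : ∀ ω ω', X ω = X ω' → I ω = I ω') (hY : ∀ ω ω', Y ω = Y ω' → I ω = I ω') :
    ∑ ω, p ω * (fib p X ω * fib p Y ω / (fib p U ω * fib p I ω)) ≤ ∑ ω, p ω := by
  have inner : ∀ a b : Ω,
      ∑ ω, (if X a = X ω then (1 : ℝ) else 0) * (if Y b = Y ω then (1 : ℝ) else 0) *
        (p ω / (fib p U ω * fib p I ω)) ≤ if I b = I a then 1 / fib p I a else 0 := by
    intro a b
    by_cases hex : ∃ w, X a = X w ∧ Y b = Y w
    · obtain ⟨w, hw1, hw2⟩ := hex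
      have hI : I b = I a := (hY _ _ hw2).trans (hX _ _ hw1).symm
      rw [if_pos hI]
      have : ∀ ω, (if X a = X ω then (1 : ℝ) else 0) * (if Y b = Y ω then (1 : ℝ) else 0) *
          (p ω / (fib p U ω * fib p I ω))
          = (if U ω = U w then p ω else 0) * (1 / (fib p U w * fib p I a)) := by
        intro ω
        by_cases hu : U ω = U w
        · obtain ⟨h1, h2⟩ := (hU _ _).1 hu
          rw [if_pos (hw1.trans h1.symm), if_pos (hw2.trans h2.symm), if_pos hu,
            fib_eq_of_eq p U hu, fib_eq_of_eq p I (hX _ _ (h1.trans hw1.symm))]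
          ring
        · rw [if_neg hu]
          by_cases h1 : X a = X ω
          · by_cases h2 : Y b = Y ω
            · exact absurd ((hU _ _).2 ⟨h1.symm.trans hw1, h2.symm.trans hw2⟩) hu
            · simp [h2]
          · simp [h1]
      rw [Finset.sum_congr rfl fun ω _ => this ω, ← Finset.sum_mul]
      change fib p U w * _ ≤ _
      rcases (fib_nonneg p hp U w).eq_or_lt with h0 | h0
      · rw [← h0]; simpa using fib_nonneg p hp I a
      · apply le_of_eq
        rw [one_div, mul_inv, ← mul_assoc, mul_inv_cancel₀ h0.ne', one_mul, one_div]
    · have : ∀ ω, (if X a = X ω then (1 : ℝ) else 0) * (if Y b = Y ω then (1 : ℝ) else 0) *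
          (p ω / (fib p U ω * fib p I ω)) = 0 := by
        intro ω
        by_cases h1 : X a = X ω
        · have h2 : ¬ Y b = Y ω := fun h2 => hex ⟨ω, h1, h2⟩
          simp [h2]
        · simp [h1]
      rw [Finset.sum_congr rfl fun ω _ => this ω]
      simp only [Finset.sum_const_zero]
      split_ifs
      · simpa using fib_nonneg p hp I a
      · exact le_rfl
  calc ∑ ω, p ω * (fib p X ω * fib p Y ω / (fib p U ω * fib p I ω))
      = ∑ ω, ∑ a, ∑ b, p a * (p b * ((if X a = X ω then (1 : ℝ) else 0) *
          (if Y b = Y ω then (1 : ℝ) else 0) * (p ω / (fib p U ω * fib p I ω)))) := by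
        refine Finset.sum_congr rfl fun ω _ => ?_
        have e1 : fib p X ω = ∑ a, p a * (if X a = X ω then (1 : ℝ) else 0) := by simp [fib]
        have e2 : fib p Y ω = ∑ b, p b * (if Y b = Y ω then (1 : ℝ) else 0) := by simp [fib]
        rw [e1, e2, Finset.sum_mul_sum, Finset.sum_div, Finset.mul_sum]
        refine Finset.sum_congr rfl fun a _ => ?_
        rw [Finset.sum_div, Finset.mul_sum]
        refine Finset.sum_congr rfl fun b _ => ?_
        ring
    _ = ∑ a, ∑ b, p a * (p b * ∑ ω, ((if X a = X ω then (1 : ℝ) else 0) *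
          (if Y b = Y ω then (1 : ℝ) else 0) * (p ω / (fib p U ω * fib p I ω)))) := by
        rw [Finset.sum_comm]
        refine Finset.sum_congr rfl fun a _ => ?_
        rw [Finset.sum_comm]
        refine Finset.sum_congr rfl fun b _ => ?_
        rw [Finset.mul_sum, Finset.mul_sum]
    _ ≤ ∑ a, ∑ b, p a * (p b * if I b = I a then 1 / fib p I a else 0) := by
        refine Finset.sum_le_sum fun a _ => Finset.sum_le_sum fun b _ => ?_
        exact mul_le_mul_of_nonneg_left (mul_le_mul_of_nonneg_left (inner a b) (hp b)) (hp a)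
    _ ≤ ∑ ω, p ω := by
        refine Finset.sum_le_sum fun a _ => ?_
        have : ∑ b, p a * (p b * if I b = I a then 1 / fib p I a else 0)
            = p a * (fib p I a * (1 / fib p I a)) := by
          rw [← Finset.mul_sum]
          congr 1
          unfold fib
          rw [Finset.sum_mul]
          refine Finset.sum_congr rfl fun b _ => ?_
          split_ifs <;> simp
        rw [this]
        rcases (fib_nonneg p hp I a).eq_or_lt with h0 | h0
        · rw [← h0]; simpa using hp a
        · rw [mul_one_div_cancel h0.ne', mul_one]

theorem ent_submod [Fintype α] [Fintype β] [Fintype γ] [Fintype δ]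
    (p : Ω → ℝ) (hp : ∀ ω, 0 ≤ p ω)
    (X : Ω → α) (Y : Ω → β) (U : Ω → γ) (I : Ω → δ)
    (hU : ∀ ω ω', U ω = U ω' ↔ X ω = X ω' ∧ Y ω = Y ω')
    (hX : ∀ ω ω', X ω = X ω' → I ω = I ω') (hY : ∀ ω ω', Y ω = Y ω' → I ω = I ω') :
    ent p I + ent p U ≤ ent p X + ent p Y := by
  have hr := ratio_sum_le p hp X Y U I hU hX hY
  have key : ∀ ω, p ω * (-Real.log (fib p I ω)) + p ω * (-Real.log (fib p U ω))
      - p ω * (-Real.log (fib p X ω)) - p ω * (-Real.log (fib p Y ω))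
      ≤ p ω * (fib p X ω * fib p Y ω / (fib p U ω * fib p I ω)) - p ω := by
    intro ω
    rcases (hp ω).eq_or_lt with h0 | h0
    · simp [← h0]
    · have a := fib_pos p hp X ω h0
      have b := fib_pos p hp Y ω h0
      have c := fib_pos p hp U ω h0
      have d := fib_pos p hp I ω h0
      have l := Real.log_le_sub_one_of_pos (div_pos (mul_pos a b) (mul_pos c d))
      rw [Real.log_div (mul_pos a b).ne' (mul_pos c d).ne', Real.log_mul a.ne' b.ne',
        Real.log_mul c.ne' d.ne'] at l
      nlinarith [mul_le_mul_of_nonneg_left l h0.le]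
  have := Finset.sum_le_sum fun ω (_ : ω ∈ Finset.univ) => key ω
  simp only [Finset.sum_sub_distrib, Finset.sum_add_distrib] at this
  rw [ent_eq, ent_eq, ent_eq, ent_eq]
  linarith

/-! ### The copy construction -/

/-- Two copies of `(Ω, p)`, conditionally independent over `B`. -/
noncomputable def cop (p : Ω → ℝ) (B : Ω → β) (w : Ω × Ω) : ℝ :=
  if B w.1 = B w.2 then p w.1 * p w.2 / fib p B w.1 else 0

theorem cop_nonneg (p : Ω → ℝ) (hp : ∀ ω, 0 ≤ p ω) (B : Ω → β) (w : Ω × Ω) :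
    0 ≤ cop p B w := by
  unfold cop
  split_ifs
  · exact div_nonneg (mul_nonneg (hp _) (hp _)) (fib_nonneg p hp B _)
  · exact le_rfl

theorem cop_fst (p : Ω → ℝ) (hp : ∀ ω, 0 ≤ p ω) (B : Ω → β) (a : Ω) :
    ∑ b, cop p B (a, b) = p a := by
  have : ∑ b, cop p B (a, b) = p a / fib p B a * fib p B a := by
    conv_rhs => rw [fib.eq_def p B a]
    conv_rhs => rw [Finset.mul_sum]
    refine Finset.sum_congr rfl fun b _ => ?_
    unfold cop
    by_cases h : B a = B b
    · simp only [h, if_true]; rw [fib_eq_of_eq p B h]; unfold fib; ring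
    · simp [h, Ne.symm h]
  rw [this]
  rcases (hp a).eq_or_lt with h0 | h0
  · simp [← h0]
  · exact div_mul_cancel₀ _ (fib_pos p hp B a h0).ne'

theorem cop_swap (p : Ω → ℝ) (B : Ω → β) (a b : Ω) : cop p B (a, b) = cop p B (b, a) := by
  unfold cop
  by_cases h : B a = B b
  · simp only [h, if_true]; rw [fib_eq_of_eq p B h, mul_comm]
  · simp [h, Ne.symm h]

theorem cop_snd (p : Ω → ℝ) (hp : ∀ ω, 0 ≤ p ω) (B : Ω → β) (b : Ω) :
    ∑ a, cop p B (a, b) = p b := by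
  rw [← cop_fst p hp B b]
  exact Finset.sum_congr rfl fun a _ => cop_swap p B a b

theorem cop_sum (p : Ω → ℝ) (hp : ∀ ω, 0 ≤ p ω) (B : Ω → β) :
    ∑ w, cop p B w = ∑ ω, p ω := by
  rw [Fintype.sum_prod_type]
  exact Finset.sum_congr rfl fun a _ => cop_fst p hp B a

theorem cop_supp (p : Ω → ℝ) (B : Ω → β) (w : Ω × Ω) (h : 0 < cop p B w) : B w.1 = B w.2 := by
  by_contra hne
  simp [cop, hne] at h

theorem fib_cop_fst (p : Ω → ℝ) (hp : ∀ ω, 0 ≤ p ω) (B : Ω → β) (X : Ω → α) (w : Ω × Ω) :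
    fib (cop p B) (fun v => X v.1) w = fib p X w.1 := by
  unfold fib
  rw [Fintype.sum_prod_type]
  refine Finset.sum_congr rfl fun a _ => ?_
  by_cases h : X a = X w.1
  · simp [h, cop_fst p hp B a]
  · simp [h]

theorem fib_cop_snd (p : Ω → ℝ) (hp : ∀ ω, 0 ≤ p ω) (B : Ω → β) (X : Ω → α) (w : Ω × Ω) :
    fib (cop p B) (fun v => X v.2) w = fib p X w.2 := by
  unfold fib
  rw [Fintype.sum_prod_type, Finset.sum_comm]
  refine Finset.sum_congr rfl fun a _ => ?_
  by_cases h : X a = X w.2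
  · simp [h, cop_snd p hp B a]
  · simp [h]

theorem cop_exp_fst (p : Ω → ℝ) (hp : ∀ ω, 0 ≤ p ω) (B : Ω → β) (f : Ω → ℝ) :
    ∑ w : Ω × Ω, cop p B w * f w.1 = ∑ ω, p ω * f ω := by
  rw [Fintype.sum_prod_type]
  refine Finset.sum_congr rfl fun a _ => ?_
  dsimp only
  rw [← Finset.sum_mul, cop_fst p hp B a]

theorem cop_exp_snd (p : Ω → ℝ) (hp : ∀ ω, 0 ≤ p ω) (B : Ω → β) (f : Ω → ℝ) :
    ∑ w : Ω × Ω, cop p B w * f w.2 = ∑ ω, p ω * f ω := by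
  rw [Fintype.sum_prod_type, Finset.sum_comm]
  refine Finset.sum_congr rfl fun a _ => ?_
  dsimp only
  rw [← Finset.sum_mul, cop_snd p hp B a]

theorem ent_cop_fst [Fintype α] (p : Ω → ℝ) (hp : ∀ ω, 0 ≤ p ω) (B : Ω → β) (X : Ω → α) :
    ent (cop p B) (fun v => X v.1) = ent p X := by
  rw [ent_eq, ent_eq, ← cop_exp_fst p hp B]
  exact Finset.sum_congr rfl fun w _ => by rw [fib_cop_fst p hp]

theorem ent_cop_snd [Fintype α] (p : Ω → ℝ) (hp : ∀ ω, 0 ≤ p ω) (B : Ω → β) (X : Ω → α) :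
    ent (cop p B) (fun v => X v.2) = ent p X := by
  rw [ent_eq, ent_eq, ← cop_exp_snd p hp B]
  exact Finset.sum_congr rfl fun w _ => by rw [fib_cop_snd p hp]

theorem ent_cop_pair [Fintype α] [Fintype β] [Fintype γ] (p : Ω → ℝ) (hp : ∀ ω, 0 ≤ p ω)
    (B : Ω → β) (X : Ω → α) (Y : Ω → γ)
    (hX : ∀ ω ω', X ω = X ω' → B ω = B ω') (hY : ∀ ω ω', Y ω = Y ω' → B ω = B ω') :
    ent (cop p B) (fun v => (X v.1, Y v.2)) = ent p X + ent p Y - ent p B := by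
  have hq := cop_nonneg p hp B
  have hf : ∀ w : Ω × Ω, 0 < cop p B w → fib (cop p B) (fun v => (X v.1, Y v.2)) w
      = fib p X w.1 * fib p Y w.2 / fib p B w.1 := by
    intro w hw
    have hB := cop_supp p B w hw
    unfold fib
    rw [Fintype.sum_prod_type, Finset.sum_mul_sum, Finset.sum_div]
    refine Finset.sum_congr rfl fun a _ => ?_
    rw [Finset.sum_div]
    refine Finset.sum_congr rfl fun b _ => ?_
    by_cases h1 : X a = X w.1
    · by_cases h2 : Y b = Y w.2
      · have e1 := hX _ _ h1
        have e2 := hY _ _ h2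
        simp only [h1, h2, if_true]
        unfold cop
        rw [if_pos (by rw [e1, e2, hB])]
        rw [fib_eq_of_eq p B e1]
        rfl
      · simp [h2]
    · simp [h1]
  rw [ent_eq, ent_eq p X, ent_eq p Y, ent_eq p B, ← cop_exp_fst p hp B, ← cop_exp_snd p hp B,
    ← cop_exp_fst p hp B (fun ω => -Real.log (fib p B ω)), ← Finset.sum_add_distrib,
    ← Finset.sum_sub_distrib]
  refine Finset.sum_congr rfl fun w _ => ?_
  rcases (hq w).eq_or_lt with h0 | h0
  · simp [← h0]
  · have a : fib p X w.1 ≠ 0 := by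
      rw [← fib_cop_fst p hp B X w]; exact (fib_pos _ hq _ w h0).ne'
    have b : fib p Y w.2 ≠ 0 := by
      rw [← fib_cop_snd p hp B Y w]; exact (fib_pos _ hq _ w h0).ne'
    have c : fib p B w.1 ≠ 0 := by
      rw [← fib_cop_fst p hp B B w]; exact (fib_pos _ hq _ w h0).ne'
    rw [hf w h0, Real.log_div (mul_ne_zero a b) c, Real.log_mul a b]
    ring

end basic

/-! ### Families of 14 variables, indexed by bit masks -/

section masks
variable {Ω T : Type*} [Fintype Ω] [Fintype T]

/-- The subtuple of `Z` selected by the bits of `m`. -/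
def tup (Z : Fin 14 → Ω → T) (m : ℕ) (ω : Ω) (i : Fin 14) : Option T :=
  if m.testBit i then some (Z i ω) else none

theorem tup_eq_iff (Z : Fin 14 → Ω → T) (m : ℕ) (ω ω' : Ω) :
    tup Z m ω = tup Z m ω' ↔ ∀ i : Fin 14, m.testBit i = true → Z i ω = Z i ω' := by
  constructor
  · intro h i hi
    have := congrFun h i
    simpa [tup, hi] using this
  · intro h
    funext i
    by_cases hi : m.testBit i = true
    · simp [tup, hi, h i hi]
    · simp [tup, hi]

/-- Entropy of the subtuple selected by `m`. -/
noncomputable def mH (p : Ω → ℝ) (Z : Fin 14 → Ω → T) (m : ℕ) : ℝ := ent p (tup Z m)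

theorem mH_sub (p : Ω → ℝ) (hp : ∀ ω, 0 ≤ p ω) (Z : Fin 14 → Ω → T) (X Y : ℕ) :
    mH p Z (X &&& Y) + mH p Z (X ||| Y) ≤ mH p Z X + mH p Z Y := by
  apply ent_submod p hp
  · intro ω ω'
    simp only [tup_eq_iff, Nat.testBit_or, Bool.or_eq_true]
    constructor
    · intro h
      exact ⟨fun i hi => h i (Or.inl hi), fun i hi => h i (Or.inr hi)⟩
    · rintro ⟨h1, h2⟩ i (hi | hi)
      · exact h1 i hi
      · exact h2 i hi
  · intro ω ω'
    simp only [tup_eq_iff, Nat.testBit_and, Bool.and_eq_true]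
    exact fun h i hi => h i hi.1
  · intro ω ω'
    simp only [tup_eq_iff, Nat.testBit_and, Bool.and_eq_true]
    exact fun h i hi => h i hi.2

theorem bit_of_and {X Y : ℕ} (h : X &&& Y = X) {i : ℕ} (hi : X.testBit i = true) :
    Y.testBit i = true := by
  rw [← h, Nat.testBit_and, Bool.and_eq_true] at hi
  exact hi.2

theorem bit_of_or {X Y : ℕ} (h : X ||| Y = Y) {i : ℕ} (hi : X.testBit i = true) :
    Y.testBit i = true := by
  rw [← h, Nat.testBit_or, hi, Bool.true_or]

theorem mH_mono (p : Ω → ℝ) (hp : ∀ ω, 0 ≤ p ω) (Z : Fin 14 → Ω → T) (X Y : ℕ)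
    (h : X &&& Y = X) : mH p Z X ≤ mH p Z Y := by
  apply ent_mono p hp
  intro ω ω'
  simp only [tup_eq_iff]
  exact fun hh i hi => hh i (bit_of_and h hi)

theorem mH_zero (p : Ω → ℝ) (hp1 : ∑ ω, p ω = 1) (Z : Fin 14 → Ω → T) : mH p Z 0 = 0 := by
  apply ent_const p hp1
  intro ω ω'
  simp [tup_eq_iff]

/-- The copy lemma: the variables selected by `N` become copies of those selected by `A`
over those selected by `B`, independent of all others given the latter. -/
theorem copy_step (p : Ω → ℝ) (hp : ∀ ω, 0 ≤ p ω) (hp1 : ∑ ω, p ω = 1)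
    (Z : Fin 14 → Ω → T) (f : Fin 14 → Fin 14) (N A B M : ℕ)
    (hMN : ∀ i : Fin 14, M.testBit i = true → N.testBit i = false)
    (hBN : ∀ i : Fin 14, B.testBit i = true → N.testBit i = false)
    (hfA : ∀ i : Fin 14, N.testBit i = true → A.testBit (f i) = true)
    (hAf : ∀ j : Fin 14, A.testBit j = true → ∃ i : Fin 14, N.testBit i = true ∧ f i = j) :
    ∃ (q : Ω × Ω → ℝ) (Z' : Fin 14 → Ω × Ω → T), (∀ w, 0 ≤ q w) ∧ ∑ w, q w = 1 ∧
      (∀ m, m &&& M = m → mH q Z' m = mH p Z m) ∧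
      (∀ Y, Y ||| B = B → mH q Z' (N ||| Y) = mH p Z (A ||| Y)) ∧
      (∀ r, r &&& M = r → B &&& r = B →
        mH q Z' (N ||| r) = mH p Z (A ||| B) + mH p Z r - mH p Z B) := by
  refine ⟨cop p (tup Z B), fun i w => if N.testBit i then Z (f i) w.2 else Z i w.1,
    cop_nonneg p hp _, (cop_sum p hp _).trans hp1, ?_, ?_, ?_⟩
  · intro m hm
    rw [mH, mH, ← ent_cop_fst p hp (tup Z B) (tup Z m)]
    apply ent_congr _ (cop_nonneg p hp _)
    intro w w' _ _
    simp only [tup_eq_iff]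
    refine forall_congr' fun i => forall_congr' fun hi => ?_
    simp [hMN i (bit_of_and hm hi)]
  · intro Y hY
    rw [mH, mH, ← ent_cop_snd p hp (tup Z B) (tup Z (A ||| Y))]
    apply ent_congr _ (cop_nonneg p hp _)
    intro w w' hw hw'
    have hs := (tup_eq_iff Z B _ _).1 (cop_supp p _ w hw)
    have hs' := (tup_eq_iff Z B _ _).1 (cop_supp p _ w' hw')
    simp only [tup_eq_iff, Nat.testBit_or, Bool.or_eq_true]
    constructor
    · rintro h i (hi | hi)
      · obtain ⟨j, hj, rfl⟩ := hAf i hi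
        simpa [hj] using h j (Or.inl hj)
      · have hb := bit_of_or hY hi
        have := h i (Or.inr hi)
        simp only [hBN i hb] at this
        rw [← hs i hb, ← hs' i hb]
        simpa using this
    · intro h i hi
      by_cases hn : N.testBit i = true
      · simpa [hn] using h (f i) (Or.inl (hfA i hn))
      · have hy := hi.resolve_left hn
        have hb := bit_of_or hY hy
        have := h i (Or.inr hy)
        rw [← hs i hb, ← hs' i hb] at this
        simpa [hn] using this
  · intro r hr hBr
    have hpair := ent_cop_pair p hp (tup Z B) (tup Z r) (tup Z (A ||| B))
      (by
        intro ω ω'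
        simp only [tup_eq_iff]
        exact fun h i hi => h i (bit_of_and hBr hi))
      (by
        intro ω ω'
        simp only [tup_eq_iff, Nat.testBit_or, Bool.or_eq_true]
        exact fun h i hi => h i (Or.inr hi))
    have : mH p Z (A ||| B) + mH p Z r - mH p Z B
        = ent p (tup Z r) + ent p (tup Z (A ||| B)) - ent p (tup Z B) := by
      simp only [mH]; ring
    rw [this, ← hpair, mH]
    apply ent_congr _ (cop_nonneg p hp _)
    intro w w' hw hw'
    have hs := (tup_eq_iff Z B _ _).1 (cop_supp p _ w hw)
    have hs' := (tup_eq_iff Z B _ _).1 (cop_supp p _ w' hw')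
    simp only [Prod.mk.injEq, tup_eq_iff, Nat.testBit_or, Bool.or_eq_true]
    constructor
    · intro h
      refine ⟨fun i hi => ?_, ?_⟩
      · simpa [hMN i (bit_of_and hr hi)] using h i (Or.inr hi)
      · rintro i (hi | hi)
        · obtain ⟨j, hj, rfl⟩ := hAf i hi
          simpa [hj] using h j (Or.inl hj)
        · rw [← hs i hi, ← hs' i hi]
          simpa [hBN i hi] using h i (Or.inr (bit_of_and hBr hi))
    · rintro ⟨h1, h2⟩ i hi
      by_cases hn : N.testBit i = true
      · simpa [hn] using h2 (f i) (Or.inl (hfA i hn))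
      · simpa [hn] using h1 i (hi.resolve_left hn)

end masks

theorem core_bound (h : ℕ → ℝ) (t : ℝ)
    (sub : ∀ X Y : ℕ, h (X &&& Y) + h (X ||| Y) ≤ h X + h Y)
    (mono : ∀ X Y : ℕ, X &&& Y = X → h X ≤ h Y)
    (h0 : h 0 = 0)
    (q14 : h 15 = h 14)
    (q50 : h 51 = h 50)
    (q92 : h 93 = h 92)
    (q120 : h 121 = h 120)
    (q156 : h 157 = h 156)
    (q198 : h 199 = h 198)
    (q210 : h 211 = h 210)
    (q212 : h 213 = h 212)
    (q226 : h 227 = h 226)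
    (q228 : h 229 = h 228)
    (s2 : h 3 = h 2 + h 1) (s60 : h 61 = h 60 + h 1) (s194 : h 195 = h 194 + h 1)
    (s204 : h 205 = h 204 + h 1) (s240 : h 241 = h 240 + h 1)
    (cp8 : ∀ Y : ℕ, Y ||| 60 = 60 → h (768 ||| Y) = h (3 ||| Y))
    (cp9 : ∀ Y : ℕ, Y ||| 828 = 828 → h (3072 ||| Y) = h (192 ||| Y))
    (cp10 : ∀ Y : ℕ, Y ||| 783 = 783 → h (12288 ||| Y) = h (48 ||| Y))
    (ci8 : ∀ r : ℕ, r &&& 255 = r → 60 &&& r = 60 →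
      h (768 ||| r) = h (768 ||| 60) + h r - h 60)
    (ci9 : ∀ r : ℕ, r &&& 1023 = r → 828 &&& r = 828 →
      h (3072 ||| r) = h (3072 ||| 828) + h r - h 828)
    (ci10 : ∀ r : ℕ, r &&& 4095 = r → 783 &&& r = 783 →
      h (12288 ||| r) = h (12288 ||| 783) + h r - h 783)
    (t1 : h 2 ≤ t) (t2 : h 4 ≤ t) (t3 : h 8 ≤ t) (t4 : h 16 ≤ t) (t5 : h 32 ≤ t) :
    32 * h 1 ≤ 28 * t := by
  have fd : ∀ m X : ℕ, h (m ||| 1) = h m → m ||| X = X → h (X ||| 1) = h X := by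
    intro m X hm hX
    have a := sub X (m ||| 1)
    have b := mono X (X ||| 1) (by
      apply Nat.eq_of_testBit_eq
      intro i
      simp only [Nat.testBit_and, Nat.testBit_or]
      cases X.testBit i <;> simp)
    have c := mono m (X &&& (m ||| 1)) (by
      apply Nat.eq_of_testBit_eq
      intro i
      have := congrArg (fun z => z.testBit i) hX
      simp only [Nat.testBit_and, Nat.testBit_or] at this ⊢
      revert this
      cases m.testBit i <;> cases X.testBit i <;> cases Nat.testBit 1 i <;> decide)
    have d : X ||| (m ||| 1) = X ||| 1 := by rw [← Nat.or_assoc, Nat.or_comm X m, hX]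
    rw [d] at a
    linarith
  have qa : h (12290 ||| 1) = h 12290 := by
    have a : h 12291 = h 51 := cp10 3 rfl
    have b : h 12290 = h 50 := cp10 2 rfl
    have c : h 51 = h 50 := q50
    exact (a.trans c).trans b.symm
  have i1 : h 16381 ≤ h 16383 := mono 16381 16383 rfl
  have i2 : h 16379 ≤ h 16383 := mono 16379 16383 rfl
  have i3 : h 16375 ≤ h 16383 := mono 16375 16383 rfl
  have i4 : h 16367 ≤ h 16383 := mono 16367 16383 rfl
  have i5 : h 16351 ≤ h 16383 := mono 16351 16383 rfl
  have i6 : h 964 + h 973 ≤ h 965 + h 972 := sub 965 972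
  have i7 : h 898 + h 963 ≤ h 899 + h 962 := sub 899 962
  have i8 : h 3842 + h 3907 ≤ h 3843 + h 3906 := sub 3843 3906
  have i9 : h 770 + h 899 ≤ h 771 + h 898 := sub 771 898
  have i10 : h 3906 + h 4035 ≤ h 3907 + h 4034 := sub 3907 4034
  have i11 : h 8 + h 14 ≤ h 10 + h 12 := sub 10 12
  have i12 : h 128 + h 134 ≤ h 130 + h 132 := sub 130 132
  have i13 : h 1016 + h 1022 ≤ h 1018 + h 1020 := sub 1018 1020
  have i14 : h 3313 + h 3319 ≤ h 3315 + h 3317 := sub 3315 3317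
  have i15 : h 3848 + h 3854 ≤ h 3850 + h 3852 := sub 3850 3852
  have i16 : h 13112 + h 13118 ≤ h 13114 + h 13116 := sub 13114 13116
  have i17 : h 13304 + h 13310 ≤ h 13306 + h 13308 := sub 13306 13308
  have i18 : h 16376 + h 16382 ≤ h 16378 + h 16380 := sub 16378 16380
  have i19 : h 0 + h 10 ≤ h 2 + h 8 := sub 2 8
  have i20 : h 241 + h 251 ≤ h 243 + h 249 := sub 243 249
  have i21 : h 3316 + h 3326 ≤ h 3318 + h 3324 := sub 3318 3324
  have i22 : h 3840 + h 3850 ≤ h 3842 + h 3848 := sub 3842 3848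
  have i23 : h 12484 + h 12494 ≤ h 12486 + h 12492 := sub 12486 12492
  have i24 : h 13104 + h 13114 ≤ h 13106 + h 13112 := sub 13106 13112
  have i25 : h 192 + h 210 ≤ h 194 + h 208 := sub 194 208
  have i26 : h 205 + h 223 ≤ h 207 + h 221 := sub 207 221
  have i27 : h 4064 + h 4082 ≤ h 4066 + h 4080 := sub 4066 4080
  have i28 : h 12512 + h 12530 ≤ h 12514 + h 12528 := sub 12514 12528
  have i29 : h 192 + h 226 ≤ h 194 + h 224 := sub 194 224
  have i30 : h 205 + h 239 ≤ h 207 + h 237 := sub 207 237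
  have i31 : h 220 + h 254 ≤ h 222 + h 252 := sub 222 252
  have i32 : h 976 + h 1010 ≤ h 978 + h 1008 := sub 978 1008
  have i33 : h 128 + h 194 ≤ h 130 + h 192 := sub 130 192
  have i34 : h 132 + h 198 ≤ h 134 + h 196 := sub 134 196
  have i35 : h 188 + h 254 ≤ h 190 + h 252 := sub 190 252
  have i36 : h 0 + h 130 ≤ h 2 + h 128 := sub 2 128
  have i37 : h 61 + h 191 ≤ h 63 + h 189 := sub 63 189
  have i38 : h 0 + h 770 ≤ h 2 + h 768 := sub 2 768
  have i39 : h 12 + h 782 ≤ h 14 + h 780 := sub 14 780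
  have i40 : h 192 + h 962 ≤ h 194 + h 960 := sub 194 960
  have i41 : h 12528 + h 13298 ≤ h 12530 + h 13296 := sub 12530 13296
  have i42 : h 48 + h 3122 ≤ h 50 + h 3120 := sub 50 3120
  have i43 : h 960 + h 4034 ≤ h 962 + h 4032 := sub 962 4032
  have i44 : h 0 + h 12290 ≤ h 2 + h 12288 := sub 2 12288
  have i45 : h 192 + h 12482 ≤ h 194 + h 12480 := sub 194 12480
  have i46 : h 768 + h 13058 ≤ h 770 + h 13056 := sub 770 13056
  have i47 : h 996 + h 13286 ≤ h 998 + h 13284 := sub 998 13284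
  have i48 : h 4092 + h 16382 ≤ h 4094 + h 16380 := sub 4094 16380
  have i49 : h 0 + h 12 ≤ h 4 + h 8 := sub 4 8
  have i50 : h 4081 + h 4093 ≤ h 4085 + h 4089 := sub 4085 4089
  have i51 : h 12529 + h 12541 ≤ h 12533 + h 12537 := sub 12533 12537
  have i52 : h 960 + h 980 ≤ h 964 + h 976 := sub 964 976
  have i53 : h 3875 + h 3895 ≤ h 3879 + h 3891 := sub 3879 3891
  have i54 : h 3851 + h 3887 ≤ h 3855 + h 3883 := sub 3855 3883
  have i55 : h 4040 + h 4076 ≤ h 4044 + h 4072 := sub 4044 4072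
  have i56 : h 12480 + h 12516 ≤ h 12484 + h 12512 := sub 12484 12512
  have i57 : h 241 + h 1013 ≤ h 245 + h 1009 := sub 245 1009
  have i58 : h 248 + h 1020 ≤ h 252 + h 1016 := sub 252 1016
  have i59 : h 12512 + h 13284 ≤ h 12516 + h 13280 := sub 12516 13280
  have i60 : h 12536 + h 13308 ≤ h 12540 + h 13304 := sub 12540 13304
  have i61 : h 15610 + h 16382 ≤ h 15614 + h 16378 := sub 15614 16378
  have i62 : h 0 + h 3076 ≤ h 4 + h 3072 := sub 4 3072
  have i63 : h 241 + h 3317 ≤ h 245 + h 3313 := sub 245 3313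
  have i64 : h 1009 + h 4085 ≤ h 1013 + h 4081 := sub 1013 4081
  have i65 : h 1018 + h 4094 ≤ h 1022 + h 4090 := sub 1022 4090
  have i66 : h 195 + h 12487 ≤ h 199 + h 12483 := sub 199 12483
  have i67 : h 241 + h 12533 ≤ h 245 + h 12529 := sub 245 12529
  have i68 : h 3322 + h 15614 ≤ h 3326 + h 15610 := sub 3326 15610
  have i69 : h 4088 + h 16380 ≤ h 4092 + h 16376 := sub 4092 16376
  have i70 : h 3879 + h 3903 ≤ h 3887 + h 3895 := sub 3887 3895
  have i71 : h 3843 + h 3883 ≤ h 3851 + h 3875 := sub 3851 3875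
  have i72 : h 4032 + h 4072 ≤ h 4040 + h 4064 := sub 4040 4064
  have i73 : h 242 + h 1018 ≤ h 250 + h 1010 := sub 250 1010
  have i74 : h 244 + h 1020 ≤ h 252 + h 1012 := sub 252 1012
  have i75 : h 3314 + h 4090 ≤ h 3322 + h 4082 := sub 3322 4082
  have i76 : h 12530 + h 13306 ≤ h 12538 + h 13298 := sub 12538 13298
  have i77 : h 15606 + h 16382 ≤ h 15614 + h 16374 := sub 15614 16374
  have i78 : h 244 + h 3324 ≤ h 252 + h 3316 := sub 252 3316
  have i79 : h 242 + h 12538 ≤ h 250 + h 12530 := sub 250 12530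
  have i80 : h 998 + h 13294 ≤ h 1006 + h 13286 := sub 1006 13286
  have i81 : h 3318 + h 15614 ≤ h 3326 + h 15606 := sub 3326 15606
  have i82 : h 0 + h 48 ≤ h 16 + h 32 := sub 16 32
  have i83 : h 206 + h 254 ≤ h 222 + h 238 := sub 222 238
  have i84 : h 965 + h 1013 ≤ h 981 + h 997 := sub 981 997
  have i85 : h 4046 + h 4094 ≤ h 4062 + h 4078 := sub 4062 4078
  have i86 : h 195 + h 979 ≤ h 211 + h 963 := sub 211 963
  have i87 : h 206 + h 990 ≤ h 222 + h 974 := sub 222 974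
  have i88 : h 236 + h 1020 ≤ h 252 + h 1004 := sub 252 1004
  have i89 : h 0 + h 3088 ≤ h 16 + h 3072 := sub 16 3072
  have i90 : h 974 + h 4062 ≤ h 990 + h 4046 := sub 990 4046
  have i91 : h 1004 + h 4092 ≤ h 1020 + h 4076 := sub 1020 4076
  have i92 : h 771 + h 13075 ≤ h 787 + h 13059 := sub 787 13059
  have i93 : h 812 + h 13116 ≤ h 828 + h 13100 := sub 828 13100
  have i94 : h 205 + h 1005 ≤ h 237 + h 973 := sub 237 973
  have i95 : h 3267 + h 4067 ≤ h 3299 + h 4035 := sub 3299 4035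
  have i96 : h 3294 + h 4094 ≤ h 3326 + h 4062 := sub 3326 4062
  have i97 : h 12480 + h 13280 ≤ h 12512 + h 13248 := sub 12512 13248
  have i98 : h 0 + h 3104 ≤ h 32 + h 3072 := sub 32 3072
  have i99 : h 195 + h 3299 ≤ h 227 + h 3267 := sub 227 3267
  have i100 : h 222 + h 3326 ≤ h 254 + h 3294 := sub 254 3294
  have i101 : h 195 + h 12515 ≤ h 227 + h 12483 := sub 227 12483
  have i102 : h 780 + h 13100 ≤ h 812 + h 13068 := sub 812 13068
  have i103 : h 787 + h 13107 ≤ h 819 + h 13075 := sub 819 13075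
  have i104 : h 908 + h 4044 ≤ h 972 + h 3980 := sub 972 3980
  have i105 : h 944 + h 4080 ≤ h 1008 + h 4016 := sub 1008 4016
  have i106 : h 12 + h 12364 ≤ h 76 + h 12300 := sub 76 12300
  have i107 : h 816 + h 13168 ≤ h 880 + h 13104 := sub 880 13104
  have i108 : h 896 + h 13248 ≤ h 960 + h 13184 := sub 960 13184
  have i109 : h 12 + h 3212 ≤ h 140 + h 3084 := sub 140 3084
  have i110 : h 48 + h 3248 ≤ h 176 + h 3120 := sub 176 3120
  have i111 : h 76 + h 12492 ≤ h 204 + h 12364 := sub 204 12364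
  have i112 : h 768 + h 13184 ≤ h 896 + h 13056 := sub 896 13056
  have i113 : h 880 + h 13296 ≤ h 1008 + h 13168 := sub 1008 13168
  have i114 : h 12 + h 3852 ≤ h 780 + h 3084 := sub 780 3084
  have i115 : h 48 + h 3888 ≤ h 816 + h 3120 := sub 816 3120
  have i116 : h 50 + h 3890 ≤ h 818 + h 3122 := sub 818 3122
  have i117 : h 140 + h 3980 ≤ h 908 + h 3212 := sub 908 3212
  have i118 : h 176 + h 4016 ≤ h 944 + h 3248 := sub 944 3248
  have i119 : h 206 + h 13262 ≤ h 974 + h 12494 := sub 974 12494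
  have e1 : h 16383 = h 13071 + h 4095 - h 783 := ci10 4095 rfl rfl
  have e2 : h 13071 = h 831 := cp10 783 rfl
  have e3 : h 831 = h 828 + h 63 - h 60 := ci8 63 rfl rfl
  have e4 : h 828 = h 63 := cp8 60 rfl
  have e5 : h 4095 = h 3900 + h 1023 - h 828 := ci9 1023 rfl rfl
  have e6 : h 3900 = h 1020 := cp9 828 rfl
  have e7 : h 1021 = h 1020 := fd 92 1020 q92 rfl
  have e8 : h 1021 = h 828 + h 253 - h 60 := ci8 253 rfl rfl
  have e9 : h 1023 = h 828 + h 255 - h 60 := ci8 255 rfl rfl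
  have e10 : h 16367 = h 13071 + h 4079 - h 783 := ci10 4079 rfl rfl
  have e11 : h 16351 = h 13071 + h 4063 - h 783 := ci10 4063 rfl rfl
  have e12 : h 15 = h 14 := fd 14 14 q14 rfl
  have e13 : h 1023 = h 1022 := fd 14 1022 q14 rfl
  have e14 : h 3852 = h 972 := cp9 780 rfl
  have e15 : h 3855 = h 3854 := fd 14 3854 q14 rfl
  have e16 : h 13119 = h 13118 := fd 14 13118 q14 rfl
  have e17 : h 13119 = h 13071 + h 831 - h 783 := ci10 831 rfl rfl
  have e18 : h 13311 = h 13310 := fd 14 13310 q14 rfl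
  have e19 : h 13311 = h 13071 + h 1023 - h 783 := ci10 1023 rfl rfl
  have e20 : h 16379 = h 16378 := fd 50 16378 q50 rfl
  have e21 : h 16381 = h 16380 := fd 92 16380 q92 rfl
  have e22 : h 16383 = h 16382 := fd 14 16382 q14 rfl
  have e23 : h 241 = h 240 + h 1 := s240
  have e24 : h 3319 = h 3318 := fd 50 3318 q50 rfl
  have e25 : h 3840 = h 960 := cp9 768 rfl
  have e26 : h 12487 = h 12486 := fd 198 12486 q198 rfl
  have e27 : h 13107 = h 13106 := fd 50 13106 q50 rfl
  have e28 : h 211 = h 210 := fd 210 210 q210 rfl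
  have e29 : h 205 = h 204 + h 1 := s204
  have e30 : h 4067 = h 4066 := fd 226 4066 q226 rfl
  have e31 : h 12515 = h 12514 := fd 226 12514 q226 rfl
  have e32 : h 227 = h 226 := fd 226 226 q226 rfl
  have e33 : h 223 = h 222 := fd 14 222 q14 rfl
  have e34 : h 253 = h 252 := fd 92 252 q92 rfl
  have e35 : h 255 = h 254 := fd 14 254 q14 rfl
  have e36 : h 221 = h 220 := fd 92 220 q92 rfl
  have e37 : h 979 = h 978 := fd 210 978 q210 rfl
  have e38 : h 199 = h 198 := fd 198 198 q198 rfl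
  have e39 : h 191 = h 190 := fd 14 190 q14 rfl
  have e40 : h 189 = h 188 := fd 156 188 q156 rfl
  have e41 : h 61 = h 60 + h 1 := s60
  have e42 : h 768 = h 3 := cp8 0 rfl
  have e43 : h 3 = h 2 + h 1 := s2
  have e44 : h 780 = h 15 := cp8 12 rfl
  have e45 : h 783 = h 782 := fd 14 782 q14 rfl
  have e46 : h 3120 = h 240 := cp9 48 rfl
  have e47 : h 12288 = h 48 := cp10 0 rfl
  have e48 : h 12291 = h 12290 := fd 12290 12290 qa rfl
  have e49 : h 12291 = h 51 := cp10 3 rfl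
  have e50 : h 12483 = h 12482 := fd 12290 12482 qa rfl
  have e51 : h 13056 = h 816 := cp10 768 rfl
  have e52 : h 816 = h 51 := cp8 48 rfl
  have e53 : h 13059 = h 13058 := fd 12290 13058 qa rfl
  have e54 : h 13059 = h 819 := cp10 771 rfl
  have e55 : h 997 = h 996 := fd 228 996 q228 rfl
  have e56 : h 4095 = h 4094 := fd 14 4094 q14 rfl
  have e57 : h 4093 = h 4092 := fd 92 4092 q92 rfl
  have e58 : h 4093 = h 3900 + h 1021 - h 828 := ci9 1021 rfl rfl
  have e59 : h 981 = h 980 := fd 212 980 q212 rfl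
  have e60 : h 249 = h 248 := fd 120 248 q120 rfl
  have e61 : h 12541 = h 12540 := fd 92 12540 q92 rfl
  have e62 : h 12537 = h 12536 := fd 120 12536 q120 rfl
  have e63 : h 3072 = h 192 := cp9 0 rfl
  have e64 : h 3076 = h 196 := cp9 4 rfl
  have e65 : h 195 = h 194 + h 1 := s194
  have e66 : h 4089 = h 4088 := fd 120 4088 q120 rfl
  have e67 : h 3903 = h 3900 + h 831 - h 828 := ci9 831 rfl rfl
  have e68 : h 251 = h 250 := fd 50 250 q50 rfl
  have e69 : h 243 = h 242 := fd 50 242 q50 rfl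
  have e70 : h 1013 = h 1012 := fd 212 1012 q212 rfl
  have e71 : h 245 = h 244 := fd 212 244 q212 rfl
  have e72 : h 3315 = h 3314 := fd 50 3314 q50 rfl
  have e73 : h 16375 = h 16374 := fd 50 16374 q50 rfl
  have e74 : h 1007 = h 1006 := fd 14 1006 q14 rfl
  have e75 : h 13295 = h 13294 := fd 14 13294 q14 rfl
  have e76 : h 13295 = h 13071 + h 1007 - h 783 := ci10 1007 rfl rfl
  have e77 : h 239 = h 238 := fd 14 238 q14 rfl
  have e78 : h 207 = h 206 := fd 14 206 q14 rfl
  have e79 : h 4063 = h 4062 := fd 14 4062 q14 rfl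
  have e80 : h 4079 = h 4078 := fd 14 4078 q14 rfl
  have e81 : h 975 = h 974 := fd 14 974 q14 rfl
  have e82 : h 1005 = h 1004 := fd 228 1004 q228 rfl
  have e83 : h 237 = h 236 := fd 228 236 q228 rfl
  have e84 : h 3088 = h 208 := cp9 16 rfl
  have e85 : h 3104 = h 224 := cp9 32 rfl
  have e86 : h 13068 = h 828 := cp10 780 rfl
  have e87 : h 12300 = h 60 := cp10 12 rfl
  have e88 : h 3084 = h 204 := cp9 12 rfl
  have e89 : h 3888 = h 1008 := cp9 816 rfl
  have e90 : h 819 = h 818 := fd 50 818 q50 rfl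
  have e91 : h 3891 = h 3890 := fd 50 3890 q50 rfl
  have e92 : h 13263 = h 13262 := fd 14 13262 q14 rfl
  have e93 : h 13263 = h 13071 + h 975 - h 783 := ci10 975 rfl rfl
  linear_combination 20 * t1 + 2 * t2 + t3 + 2 * t4 + 3 * t5 + 20 * i1 + 2 * i2 + i3 + 2 * i4
    + 3 * i5 + i6 + i7 + i8 + i9 + i10 + 10 * i11 + i12 + 2 * i13 + i14 + i15 + i16 + i17 + i18
    + 10 * i19 + 2 * i20 + 2 * i21 + i22 + i23 + i24 + i25 + 3 * i26 + i27 + i28 + 2 * i29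
    + i30 + 3 * i31 + i32 + 3 * i33 + i34 + 16 * i35 + 4 * i36 + 16 * i37 + 2 * i38 + 4 * i39
    + 2 * i40 + i41 + i42 + i43 + 6 * i44 + 2 * i45 + 3 * i46 + i47 + 20 * i48 + i49 + i50
    + i51 + i52 + i53 + i54 + i55 + i56 + i57 + 2 * i58 + i59 + i60 + i61 + i62 + i63 + i64
    + i65 + i66 + i67 + i68 + i69 + i70 + i71 + i72 + i73 + i74 + i75 + i76 + i77 + 2 * i78
    + i79 + i80 + i81 + i82 + i83 + i84 + 2 * i85 + i86 + 2 * i87 + 2 * i88 + i89 + 2 * i90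
    + i91 + i92 + i93 + i94 + i95 + 3 * i96 + i97 + 2 * i98 + i99 + 3 * i100 + i101 + i102
    + i103 + i104 + i105 + i106 + i107 + i108 + i109 + i110 + i111 + i112 + i113 + 3 * i114
    + 3 * i115 + i116 + i117 + i118 + i119 + 5 * e1 - 4 * e2 - 6 * e3 - 10 * e4 + 19 * e5
    - 3 * e6 + 5 * e7 - 26 * e8 + 17 * e9 - 2 * e10 - 3 * e11 + 6 * e12 + e13 - 2 * e14 + e15
    + e16 - e17 + e18 - e19 - 2 * e20 - 20 * e21 + 23 * e22 - 5 * e23 - e24 - e25 - e26 - e27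
    + e28 - 5 * e29 - e30 - e31 + 2 * e32 - 3 * e33 - 26 * e34 + 17 * e35 + 3 * e36 - e37 + e38
    - 16 * e39 + 16 * e40 - 16 * e41 - 2 * e42 - 2 * e43 + 6 * e44 + 4 * e45 + 5 * e46
    + 6 * e47 + 6 * e48 - 6 * e49 + 2 * e50 + 4 * e51 + 6 * e52 + 3 * e53 - 2 * e54 + e55
    - 14 * e56 + 20 * e57 - 21 * e58 + e59 + 2 * e60 - e61 + e62 + 4 * e63 - e64 - 4 * e65
    + e66 - e67 - 2 * e68 + 2 * e69 - e70 + 3 * e71 + e72 - e73 - e74 + e75 - e76 - e77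
    + 4 * e78 - 3 * e79 - 2 * e80 - e81 - e82 + 2 * e83 - e84 - 2 * e85 + e86 + e87 + 4 * e88
    - 3 * e89 - e90 + e91 + e92 - e93 - 28 * h0

/-- The family of 8 variables, padded with constants to one of 14 variables. -/
def padFam {Ω : Type*} {α : Fin 8 → Type*} (S : (i : Fin 8) → Ω → α i) (i : Fin 14) (ω : Ω) :
    Option (Σ i : Fin 8, α i) :=
  if h : (i : ℕ) < 8 then some ⟨⟨i, h⟩, S ⟨i, h⟩ ω⟩ else none

/-- The set of parties encoded by a mask. -/
def ofMask (m : ℕ) : Finset (Fin 8) := Finset.univ.filter fun i : Fin 8 => m.testBit i = true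

theorem entS_ofMask {Ω : Type*} [Fintype Ω] {α : Fin 8 → Type*} [∀ i, Fintype (α i)]
    (p : Ω → ℝ) (hp0 : ∀ ω, 0 ≤ p ω) (S : (i : Fin 8) → Ω → α i) (m : ℕ) (V : Finset (Fin 8))
    (hV : V = ofMask m) :
    entS p S V = mH p (padFam S) m := by
  subst hV
  unfold entS mH
  apply ent_congr p hp0
  intro ω ω' _ _
  rw [tup_eq_iff]
  constructor
  · intro h i hi
    unfold padFam
    by_cases h8 : (i : ℕ) < 8
    · have := congrFun h ⟨⟨i, h8⟩, by simpa [ofMask] using hi⟩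
      simp only at this
      simp [h8, this]
    · simp [h8]
  · intro h
    funext i
    obtain ⟨i, hi⟩ := i
    have hi' : m.testBit i = true := by simpa [ofMask] using hi
    have := h ⟨i, by omega⟩ hi'
    simpa [padFam] using this

theorem ent_single {Ω : Type*} [Fintype Ω] {α : Fin 8 → Type*} [∀ i, Fintype (α i)]
    (p : Ω → ℝ) (hp0 : ∀ ω, 0 ≤ p ω) (S : (i : Fin 8) → Ω → α i) (m : ℕ) (i : Fin 8)
    (hV : {i} = ofMask m) :
    mH p (padFam S) m = ent p (S i) := by
  rw [← entS_ofMask p hp0 S m {i} hV]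
  unfold entS
  apply ent_congr p hp0
  intro ω ω' _ _
  constructor
  · intro h
    exact congrFun h ⟨i, by simp⟩
  · intro h
    funext j
    obtain ⟨j, hj⟩ := j
    obtain rfl := Finset.mem_singleton.1 hj
    exact h

set_option maxRecDepth 100000 in
/-- The bound `8/7`, in the form of an upper bound for the entropy of the secret. -/
theorem secret_bound
    {Ω : Type*} [Fintype Ω] {α : Fin 8 → Type*} [∀ i, Fintype (α i)]
    (p : Ω → ℝ) (hp0 : ∀ ω, 0 ≤ p ω) (hp1 : ∑ ω, p ω = 1)
    (S : (i : Fin 8) → Ω → α i)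
    (hqual : ∀ V : Finset (Fin 8), MinQual V →
      entS p S (insert 0 V) - entS p S V = 0)
    (hunqual : ∀ V : Finset (Fin 8), V ⊆ ({1, 2, 3, 4, 5, 6, 7} : Finset (Fin 8)) →
      (∀ W : Finset (Fin 8), MinQual W → ¬ W ⊆ V) →
      entS p S (insert 0 V) - entS p S V = ent p (S 0)) (t : ℝ)
    (t1 : ent p (S 1) ≤ t) (t2 : ent p (S 2) ≤ t) (t3 : ent p (S 3) ≤ t)
    (t4 : ent p (S 4) ≤ t) (t5 : ent p (S 5) ≤ t) :
    32 * ent p (S 0) ≤ 28 * t := by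
  obtain ⟨p1, Z1, n1, o1, l1, c1, d1⟩ := copy_step p hp0 hp1 (padFam S)
    ![0, 0, 0, 0, 0, 0, 0, 0, 0, 1, 0, 0, 0, 0] 768 3 60 255
    (by decide) (by decide) (by decide) (by decide)
  obtain ⟨p2, Z2, n2, o2, l2, c2, d2⟩ := copy_step p1 n1 o1 Z1
    ![0, 0, 0, 0, 0, 0, 0, 0, 0, 0, 6, 7, 0, 0] 3072 192 828 1023
    (by decide) (by decide) (by decide) (by decide)
  obtain ⟨p3, Z3, n3, o3, l3, c3, d3⟩ := copy_step p2 n2 o2 Z2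
    ![0, 0, 0, 0, 0, 0, 0, 0, 0, 0, 0, 0, 4, 5] 12288 48 783 4095
    (by decide) (by decide) (by decide) (by decide)
  have up {m k l : ℕ} (h : m &&& k = m) (hk : k &&& l = k) : m &&& l = m := by
    rw [← h, Nat.and_assoc, hk]
  have l32 : ∀ m, m &&& 1023 = m → mH p3 Z3 m = mH p1 Z1 m := fun m h => by
    rw [l3 m (up h rfl), l2 m h]
  have l31 : ∀ m, m &&& 255 = m → mH p3 Z3 m = mH p (padFam S) m := fun m h => by
    rw [l32 m (up h rfl), l1 m h]
  have subOf {Y a b : ℕ} (h : Y ||| b = b) (c : ℕ) (hb : (a ||| b) &&& c = a ||| b) :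
      (a ||| Y) &&& c = a ||| Y := by
    apply up (k := a ||| b) _ hb
    apply Nat.eq_of_testBit_eq
    intro i
    have := congrArg (fun z => z.testBit i) h
    simp only [Nat.testBit_and, Nat.testBit_or] at this ⊢
    revert this
    cases a.testBit i <;> cases Y.testBit i <;> cases b.testBit i <;> decide
  have e0 : mH p3 Z3 1 = ent p (S 0) := by
    rw [l31 1 rfl]; exact ent_single p hp0 S 1 0 (by decide)
  have qual : ∀ m m' : ℕ, m &&& 255 = m → m' &&& 255 = m' → MinQual (ofMask m) →
      insert 0 (ofMask m) = ofMask m' → mH p3 Z3 m' = mH p3 Z3 m := by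
    intro m m' h h' hm hm'
    have := hqual (ofMask m) hm
    rw [entS_ofMask p hp0 S m' _ hm', entS_ofMask p hp0 S m _ rfl] at this
    rw [l31 m h, l31 m' h']
    linarith
  have sec : ∀ m m' : ℕ, m &&& 255 = m → m' &&& 255 = m' →
      ofMask m ⊆ ({1, 2, 3, 4, 5, 6, 7} : Finset (Fin 8)) →
      (∀ W ∈ (ofMask m).powerset, ¬ MinQual W) →
      insert 0 (ofMask m) = ofMask m' → mH p3 Z3 m' = mH p3 Z3 m + mH p3 Z3 1 := by
    intro m m' h h' hs hm hm'
    have := hunqual (ofMask m) hs fun W hW hsub => hm W (Finset.mem_powerset.2 hsub) hW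
    rw [entS_ofMask p hp0 S m' _ hm', entS_ofMask p hp0 S m _ rfl] at this
    rw [e0, l31 m h, l31 m' h']
    linarith
  rw [← e0]
  apply core_bound (mH p3 Z3) t (mH_sub p3 n3 Z3) (mH_mono p3 n3 Z3) (mH_zero p3 o3 Z3)
  iterate 10 exact qual _ _ rfl rfl (by unfold MinQual; decide) (by decide)
  iterate 5 exact sec _ _ rfl rfl (by decide) (by unfold MinQual; decide) (by decide)
  · intro Y hY
    rw [l32 _ (subOf hY _ rfl), l32 _ (subOf hY _ rfl), c1 Y hY,
      l1 _ (subOf hY _ rfl)]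
  · intro Y hY
    rw [l3 _ (subOf hY _ rfl), l3 _ (subOf hY _ rfl), c2 Y hY,
      l2 _ (subOf hY _ rfl)]
  · intro Y hY
    rw [c3 Y hY, l3 _ (subOf hY _ rfl)]
  · intro r hr hB
    rw [l32 _ (subOf (b := 255) (by
      apply Nat.eq_of_testBit_eq
      intro i
      have := congrArg (fun z => z.testBit i) hr
      simp only [Nat.testBit_and, Nat.testBit_or] at this ⊢
      revert this
      cases r.testBit i <;> cases Nat.testBit 255 i <;> decide) _ rfl), d1 r hr hB,
      l31 r hr, l31 60 rfl, l32 (768 ||| 60) rfl, c1 60 rfl]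
  · intro r hr hB
    rw [l3 _ (subOf (b := 1023) (by
      apply Nat.eq_of_testBit_eq
      intro i
      have := congrArg (fun z => z.testBit i) hr
      simp only [Nat.testBit_and, Nat.testBit_or] at this ⊢
      revert this
      cases r.testBit i <;> cases Nat.testBit 1023 i <;> decide) _ rfl), d2 r hr hB,
      l32 r hr, l32 828 rfl, l3 (3072 ||| 828) rfl, c2 828 rfl]
  · intro r hr hB
    rw [d3 r hr hB, l3 r hr, l3 783 rfl, c3 783 rfl]
  · rw [l31 2 rfl, ent_single p hp0 S 2 1 (by decide)]; exact t1
  · rw [l31 4 rfl, ent_single p hp0 S 4 2 (by decide)]; exact t2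
  · rw [l31 8 rfl, ent_single p hp0 S 8 3 (by decide)]; exact t3
  · rw [l31 16 rfl, ent_single p hp0 S 16 4 (by decide)]; exact t4
  · rw [l31 32 rfl, ent_single p hp0 S 32 5 (by decide)]; exact t5

/-- For every perfect secret sharing scheme `(S_0, S_1, …, S_7)` realizing the access
structure `V₀` on the Vámos matroid (with secret `S_0` of positive entropy), the
information ratio satisfies `max{H(S_1),…,H(S_7)} / H(S_0) ≥ 561/491`. -/
theorem vamos_information_ratio
    {Ω : Type*} [Fintype Ω] {α : Fin 8 → Type*} [∀ i, Fintype (α i)]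
    (p : Ω → ℝ) (hp0 : ∀ ω, 0 ≤ p ω) (hp1 : ∑ ω, p ω = 1)
    (S : (i : Fin 8) → Ω → α i)
    (hsec : 0 < ent p (S 0))
    (hqual : ∀ V : Finset (Fin 8), MinQual V →
      entS p S (insert 0 V) - entS p S V = 0)
    (hunqual : ∀ V : Finset (Fin 8), V ⊆ ({1, 2, 3, 4, 5, 6, 7} : Finset (Fin 8)) →
      (∀ W : Finset (Fin 8), MinQual W → ¬ W ⊆ V) →
      entS p S (insert 0 V) - entS p S V = ent p (S 0)) :
    max (ent p (S 1)) (max (ent p (S 2)) (max (ent p (S 3)) (max (ent p (S 4))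
      (max (ent p (S 5)) (max (ent p (S 6)) (ent p (S 7)))))))
        / ent p (S 0) ≥ 561 / 491 := by
  set t := max (ent p (S 1)) (max (ent p (S 2)) (max (ent p (S 3)) (max (ent p (S 4))
      (max (ent p (S 5)) (max (ent p (S 6)) (ent p (S 7))))))) with ht
  have h := secret_bound p hp0 hp1 S hqual hunqual t (by simp [ht]) (by simp [ht]) (by simp [ht])
    (by simp [ht]) (by simp [ht])
  rw [ge_iff_le, le_div_iff₀ hsec]
  linarith
end

section
/- For every almost entropic point x ∈ Γ̄*_4 (with coordinates indexed by nonempty subsets of {A,B,C,D}), the inequality Ing(x) + (3/19)·x_{ABCD} ≥ 0 holds, where Ing(x) = I(A;B|C) + I(A;B|D) + I(C;D) − I(A;B) is evaluated as the corresponding linear combination of the coordinates of x and x_{ABCD} is the coordinate indexed by the full set {A,B,C,D}. -/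
open scoped Classical

/-- Index set for the coordinates of `V_n = ℝ^{2^n − 1}`: the nonempty subsets of `[n]`. -/
abbrev EIndex (n : ℕ) := { V : Finset (Fin n) // V.Nonempty }

/-- A point `x ∈ ℝ^{2^n−1}` is entropic if it is the entropy profile of some tuple
`(X_1,…,X_n)` of jointly distributed random variables taking finitely many values:
`x_V = H(X_V)` for every nonempty `V ⊆ [n]`. -/
def IsEntropic {n : ℕ} (x : EIndex n → ℝ) : Prop :=
  ∃ (m k : ℕ) (p : Fin m → ℝ),
    (∀ ω, 0 ≤ p ω) ∧ (∑ ω, p ω = 1) ∧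
    ∃ X : Fin n → Fin m → Fin k,
      ∀ V : EIndex n, x V = ent p (fun ω => fun i : V.1 => X i ω)

/-- The Ingleton quantity `I(A;B|C) + I(A;B|D) + I(C;D) − I(A;B)` evaluated as a linear
combination of the coordinates of a point `x ∈ ℝ^{15}`, where the four indices
`A, B, C, D` are `0, 1, 2, 3 : Fin 4`. -/
noncomputable def Ing4 (x : EIndex 4 → ℝ) : ℝ :=
  (x ⟨{0, 2}, by decide⟩ + x ⟨{1, 2}, by decide⟩
      - x ⟨{0, 1, 2}, by decide⟩ - x ⟨{2}, by decide⟩)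
    + (x ⟨{0, 3}, by decide⟩ + x ⟨{1, 3}, by decide⟩
      - x ⟨{0, 1, 3}, by decide⟩ - x ⟨{3}, by decide⟩)
    + (x ⟨{2}, by decide⟩ + x ⟨{3}, by decide⟩ - x ⟨{2, 3}, by decide⟩)
    - (x ⟨{0}, by decide⟩ + x ⟨{1}, by decide⟩ - x ⟨{0, 1}, by decide⟩)

/-! ### Entropy as a sum over the sample space -/

/-- Probability of the atom of `X` containing `ω`. -/
noncomputable def prb {Ω α : Type*} [Fintype Ω] (p : Ω → ℝ) (X : Ω → α) (ω : Ω) : ℝ :=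
  ∑ ω' : Ω, if X ω' = X ω then p ω' else 0

/-- Entropy as an expectation over the sample space. -/
noncomputable def HH {Ω α : Type*} [Fintype Ω] (p : Ω → ℝ) (X : Ω → α) : ℝ :=
  ∑ ω : Ω, p ω * -Real.log (prb p X ω)

lemma ent_eq_HH {Ω α : Type*} [Fintype Ω] [Fintype α] (p : Ω → ℝ) (X : Ω → α) :
    ent p X = HH p X := by
  unfold ent HH
  simp only [Real.negMulLog, neg_mul, mul_neg]
  have : ∀ a : α, -((∑ ω : Ω, if X ω = a then p ω else 0) *
      Real.log (∑ ω : Ω, if X ω = a then p ω else 0))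
      = ∑ ω : Ω, if X ω = a then -(p ω * Real.log (prb p X ω)) else 0 := by
    intro a
    rw [Finset.sum_mul, ← Finset.sum_neg_distrib]
    refine Finset.sum_congr rfl fun ω _ => ?_
    split_ifs with h
    · subst h; rfl
    · simp
  rw [Finset.sum_congr rfl fun a _ => this a, Finset.sum_comm]
  simp

lemma prb_congr {Ω α β : Type*} [Fintype Ω] (p : Ω → ℝ) (X : Ω → α) (Y : Ω → β) (ω : Ω)
    (hp : p ω ≠ 0)
    (h : ∀ ω ω', p ω ≠ 0 → p ω' ≠ 0 → (X ω = X ω' ↔ Y ω = Y ω')) :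
    prb p X ω = prb p Y ω := by
  unfold prb
  refine Finset.sum_congr rfl fun ω' _ => ?_
  by_cases h0 : p ω' = 0
  · simp [h0]
  · simp only [h ω' ω h0 hp]

lemma HH_congr {Ω α β : Type*} [Fintype Ω] (p : Ω → ℝ) (X : Ω → α) (Y : Ω → β)
    (h : ∀ ω ω', p ω ≠ 0 → p ω' ≠ 0 → (X ω = X ω' ↔ Y ω = Y ω')) :
    HH p X = HH p Y := by
  unfold HH
  refine Finset.sum_congr rfl fun ω _ => ?_
  by_cases hp : p ω = 0
  · simp [hp]
  · rw [prb_congr p X Y ω hp h]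

lemma le_prb {Ω α : Type*} [Fintype Ω] {p : Ω → ℝ} (hp : ∀ ω, 0 ≤ p ω) (X : Ω → α) (ω : Ω) :
    p ω ≤ prb p X ω := by
  unfold prb
  have := Finset.single_le_sum (f := fun ω' => if X ω' = X ω then p ω' else 0)
    (fun i _ => by split_ifs <;> simp [hp]) (Finset.mem_univ ω)
  simpa using this

lemma prb_nonneg {Ω α : Type*} [Fintype Ω] {p : Ω → ℝ} (hp : ∀ ω, 0 ≤ p ω) (X : Ω → α) (ω : Ω) :
    0 ≤ prb p X ω := (hp ω).trans (le_prb hp X ω)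

lemma prb_pos {Ω α : Type*} [Fintype Ω] {p : Ω → ℝ} (hp : ∀ ω, 0 ≤ p ω) (X : Ω → α) {ω : Ω}
    (h : p ω ≠ 0) : 0 < prb p X ω :=
  lt_of_lt_of_le (lt_of_le_of_ne (hp ω) (Ne.symm h)) (le_prb hp X ω)

lemma prb_eq_of_eq {Ω α : Type*} [Fintype Ω] (p : Ω → ℝ) (X : Ω → α) {ω ω' : Ω}
    (h : X ω = X ω') : prb p X ω = prb p X ω' := by
  unfold prb; rw [h]

lemma HH_mono {Ω α β : Type*} [Fintype Ω] {p : Ω → ℝ} (hp : ∀ ω, 0 ≤ p ω)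
    (X : Ω → α) (Y : Ω → β) (h : ∀ ω ω', Y ω = Y ω' → X ω = X ω') : HH p X ≤ HH p Y := by
  unfold HH
  refine Finset.sum_le_sum fun ω _ => ?_
  by_cases h0 : p ω = 0
  · simp [h0]
  refine mul_le_mul_of_nonneg_left (neg_le_neg ?_) (hp ω)
  refine Real.log_le_log (prb_pos hp Y h0) ?_
  unfold prb
  refine Finset.sum_le_sum fun ω' _ => ?_
  by_cases h1 : Y ω' = Y ω
  · rw [if_pos h1, if_pos (h _ _ h1)]
  · rw [if_neg h1]; split_ifs <;> simp [hp]

lemma HH_const {Ω α : Type*} [Fintype Ω] {p : Ω → ℝ} (hs : ∑ ω, p ω = 1)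
    (X : Ω → α) (h : ∀ ω ω', X ω = X ω') : HH p X = 0 := by
  unfold HH
  refine Finset.sum_eq_zero fun ω _ => ?_
  have : prb p X ω = 1 := by
    unfold prb
    rw [← hs]
    exact Finset.sum_congr rfl fun ω' _ => if_pos (h _ _)
  simp [this]

lemma submod_inner {Ω α β γ : Type*} [Fintype Ω] {p : Ω → ℝ} (hp : ∀ ω, 0 ≤ p ω)
    (X : Ω → α) (Y : Ω → β) (Z : Ω → γ) (a b : Ω) :
    (∑ ω, if (X a, Z a) = (X ω, Z ω) ∧ (Y b, Z b) = (Y ω, Z ω) then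
      p ω / (prb p (fun ω => (X ω, Y ω, Z ω)) ω * prb p Z ω) else 0)
      ≤ if Z b = Z a then 1 / prb p Z a else 0 := by
  by_cases hex : ∃ w, (X a, Z a) = (X w, Z w) ∧ (Y b, Z b) = (Y w, Z w)
  · obtain ⟨w, h1, h2⟩ := hex
    simp only [Prod.mk.injEq] at h1 h2
    rw [if_pos (h2.2.trans h1.2.symm)]
    have key : (∑ ω, if (X a, Z a) = (X ω, Z ω) ∧ (Y b, Z b) = (Y ω, Z ω) then
        p ω / (prb p (fun ω => (X ω, Y ω, Z ω)) ω * prb p Z ω) else 0)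
        = prb p (fun ω => (X ω, Y ω, Z ω)) w /
          (prb p (fun ω => (X ω, Y ω, Z ω)) w * prb p Z a) := by
      conv_rhs => rw [prb, Finset.sum_div]
      refine Finset.sum_congr rfl fun ω _ => ?_
      by_cases hc : (fun ω => (X ω, Y ω, Z ω)) ω = (fun ω => (X ω, Y ω, Z ω)) w
      · have e1 := prb_eq_of_eq p (fun ω => (X ω, Y ω, Z ω)) hc
        simp only [Prod.mk.injEq] at hc
        have e2 : prb p Z ω = prb p Z a := prb_eq_of_eq p Z (hc.2.2.trans h1.2.symm)
        rw [if_pos, if_pos, e1, e2]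
        · rfl
        · simp [hc]
        · simp [hc, h1, h2]
      · rw [if_neg, if_neg hc, zero_div]
        rintro ⟨g1, g2⟩
        apply hc
        simp only [Prod.mk.injEq] at g1 g2 ⊢
        exact ⟨g1.1.symm.trans h1.1, g2.1.symm.trans h2.1, g1.2.symm.trans h1.2⟩
    rw [key]
    by_cases h0 : prb p (fun ω => (X ω, Y ω, Z ω)) w = 0
    · rw [h0]; simp [prb_nonneg hp]
    · rw [div_mul_eq_div_div, div_self h0]
  · push Not at hex
    rw [Finset.sum_eq_zero]
    · split_ifs
      · exact div_nonneg zero_le_one (prb_nonneg hp _ _)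
      · exact le_rfl
    · intro ω _
      rw [if_neg]
      rintro ⟨h1, h2⟩
      exact hex ω h1 h2

lemma HH_submod {Ω α β γ : Type*} [Fintype Ω] {p : Ω → ℝ} (hp : ∀ ω, 0 ≤ p ω)
    (hs : ∑ ω, p ω = 1) (X : Ω → α) (Y : Ω → β) (Z : Ω → γ) :
    HH p (fun ω => (X ω, Y ω, Z ω)) + HH p Z
      ≤ HH p (fun ω => (X ω, Z ω)) + HH p (fun ω => (Y ω, Z ω)) := by
  set XYZ : Ω → α × β × γ := fun ω => (X ω, Y ω, Z ω) with hXYZ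
  set XZ : Ω → α × γ := fun ω => (X ω, Z ω) with hXZ
  set YZ : Ω → β × γ := fun ω => (Y ω, Z ω) with hYZ
  have hsum : ∑ ω, p ω * (prb p XZ ω * prb p YZ ω / (prb p XYZ ω * prb p Z ω)) ≤ 1 := by
    have e : ∀ ω, p ω * (prb p XZ ω * prb p YZ ω / (prb p XYZ ω * prb p Z ω))
        = ∑ a, ∑ b, p a * p b * (if XZ a = XZ ω ∧ YZ b = YZ ω then
            p ω / (prb p XYZ ω * prb p Z ω) else 0) := by
      intro ω
      have : p ω * (prb p XZ ω * prb p YZ ω / (prb p XYZ ω * prb p Z ω))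
        = (prb p XZ ω * prb p YZ ω) * (p ω / (prb p XYZ ω * prb p Z ω)) := by ring
      rw [this]
      generalize p ω / (prb p XYZ ω * prb p Z ω) = c
      unfold prb
      rw [Finset.sum_mul_sum, Finset.sum_mul]
      refine Finset.sum_congr rfl fun a _ => ?_
      rw [Finset.sum_mul]
      refine Finset.sum_congr rfl fun b _ => ?_
      by_cases h1 : XZ a = XZ ω <;> by_cases h2 : YZ b = YZ ω <;> simp [h1, h2]
    rw [Finset.sum_congr rfl fun ω _ => e ω, Finset.sum_comm]
    calc _ = ∑ a, ∑ b, p a * p b * ∑ ω, (if XZ a = XZ ω ∧ YZ b = YZ ω then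
            p ω / (prb p XYZ ω * prb p Z ω) else 0) := by
          refine Finset.sum_congr rfl fun a _ => ?_
          rw [Finset.sum_comm]
          refine Finset.sum_congr rfl fun b _ => ?_
          rw [Finset.mul_sum]
      _ ≤ ∑ a, ∑ b, p a * p b * (if Z b = Z a then 1 / prb p Z a else 0) := by
          refine Finset.sum_le_sum fun a _ => Finset.sum_le_sum fun b _ => ?_
          exact mul_le_mul_of_nonneg_left (submod_inner hp X Y Z a b) (mul_nonneg (hp a) (hp b))
      _ = ∑ a, p a * (prb p Z a / prb p Z a) := by
          refine Finset.sum_congr rfl fun a _ => ?_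
          conv_rhs => rw [show prb p Z a / prb p Z a = prb p Z a * (1 / prb p Z a) by ring]
          nth_rewrite 2 [prb]
          rw [Finset.sum_mul, Finset.mul_sum]
          refine Finset.sum_congr rfl fun b _ => ?_
          split_ifs <;> ring
      _ ≤ ∑ a, p a := by
          refine Finset.sum_le_sum fun a _ => ?_
          exact mul_le_of_le_one_right (hp a) (div_self_le_one _)
      _ = 1 := hs
  have hpt : ∀ ω, p ω - p ω * (prb p XZ ω * prb p YZ ω / (prb p XYZ ω * prb p Z ω)) ≤
      (p ω * -Real.log (prb p XZ ω) + p ω * -Real.log (prb p YZ ω))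
        - (p ω * -Real.log (prb p XYZ ω) + p ω * -Real.log (prb p Z ω)) := by
    intro ω
    by_cases h0 : p ω = 0
    · simp [h0]
    have h1 := prb_pos hp XZ h0
    have h2 := prb_pos hp YZ h0
    have h3 := prb_pos hp XYZ h0
    have h4 := prb_pos hp Z h0
    have hlog := Real.log_le_sub_one_of_pos (div_pos (mul_pos h1 h2) (mul_pos h3 h4))
    rw [Real.log_div (mul_pos h1 h2).ne' (mul_pos h3 h4).ne', Real.log_mul h1.ne' h2.ne',
      Real.log_mul h3.ne' h4.ne'] at hlog
    have := mul_le_mul_of_nonneg_left hlog (hp ω)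
    linarith
  have := Finset.sum_le_sum fun ω (_ : ω ∈ Finset.univ) => hpt ω
  simp only [Finset.sum_sub_distrib, Finset.sum_add_distrib] at this
  unfold HH
  linarith

/-! ### The copy construction -/

/-- Two conditionally independent copies of the space over `T`. -/
noncomputable def cpm {Ω τ : Type*} [Fintype Ω] (p : Ω → ℝ) (T : Ω → τ) (q : Ω × Ω) : ℝ :=
  if T q.2 = T q.1 then p q.1 * p q.2 / prb p T q.1 else 0

lemma cpm_nonneg {Ω τ : Type*} [Fintype Ω] {p : Ω → ℝ} (hp : ∀ ω, 0 ≤ p ω) (T : Ω → τ)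
    (q : Ω × Ω) : 0 ≤ cpm p T q := by
  unfold cpm
  split_ifs
  · exact div_nonneg (mul_nonneg (hp _) (hp _)) (prb_nonneg hp _ _)
  · exact le_rfl

lemma cpm_symm {Ω τ : Type*} [Fintype Ω] (p : Ω → ℝ) (T : Ω → τ)
    (a b : Ω) : cpm p T (a, b) = cpm p T (b, a) := by
  unfold cpm
  by_cases h : T b = T a
  · simp only [if_pos h, if_pos h.symm, prb_eq_of_eq p T h]; ring
  · simp only [if_neg h, if_neg (Ne.symm h)]

lemma cpm_marg {Ω τ : Type*} [Fintype Ω] {p : Ω → ℝ} (hp : ∀ ω, 0 ≤ p ω) (T : Ω → τ)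
    (a : Ω) : ∑ b, cpm p T (a, b) = p a := by
  have : ∀ b, cpm p T (a, b) = p a / prb p T a * (if T b = T a then p b else 0) := by
    intro b; unfold cpm; split_ifs <;> ring
  rw [Finset.sum_congr rfl fun b _ => this b, ← Finset.mul_sum]
  change p a / prb p T a * prb p T a = p a
  by_cases h0 : p a = 0
  · simp [h0]
  · exact div_mul_cancel₀ _ (prb_pos hp T h0).ne'

lemma cpm_sum_fst {Ω τ : Type*} [Fintype Ω] {p : Ω → ℝ} (hp : ∀ ω, 0 ≤ p ω) (T : Ω → τ)
    (F : Ω → ℝ) : ∑ q, cpm p T q * F q.1 = ∑ ω, p ω * F ω := by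
  rw [Fintype.sum_prod_type]
  refine Finset.sum_congr rfl fun a _ => ?_
  dsimp only
  rw [← Finset.sum_mul, cpm_marg hp]

lemma cpm_sum_snd {Ω τ : Type*} [Fintype Ω] {p : Ω → ℝ} (hp : ∀ ω, 0 ≤ p ω) (T : Ω → τ)
    (F : Ω → ℝ) : ∑ q, cpm p T q * F q.2 = ∑ ω, p ω * F ω := by
  rw [Fintype.sum_prod_type_right]
  refine Finset.sum_congr rfl fun a _ => ?_
  dsimp only
  rw [← Finset.sum_mul, Finset.sum_congr rfl fun b _ => cpm_symm p T b a, cpm_marg hp]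

lemma cpm_sum {Ω τ : Type*} [Fintype Ω] {p : Ω → ℝ} (hp : ∀ ω, 0 ≤ p ω) (T : Ω → τ) :
    ∑ q, cpm p T q = ∑ ω, p ω := by
  simpa using cpm_sum_fst hp T (fun _ => 1)

lemma prb_eq_mul {Ω α : Type*} [Fintype Ω] (p : Ω → ℝ) (X : Ω → α) (ω : Ω) :
    prb p X ω = ∑ ω', p ω' * (if X ω' = X ω then 1 else 0) := by
  unfold prb; simp

lemma HH_fst {Ω τ α : Type*} [Fintype Ω] {p : Ω → ℝ} (hp : ∀ ω, 0 ≤ p ω) (T : Ω → τ)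
    (X : Ω → α) : HH (cpm p T) (fun q => X q.1) = HH p X := by
  have : ∀ q, prb (cpm p T) (fun q => X q.1) q = prb p X q.1 := fun q => by
    rw [prb_eq_mul, prb_eq_mul]
    exact cpm_sum_fst hp T (fun w => if X w = X q.1 then 1 else 0)
  unfold HH
  simp only [this]
  exact cpm_sum_fst hp T (fun w => -Real.log (prb p X w))

lemma HH_snd {Ω τ α : Type*} [Fintype Ω] {p : Ω → ℝ} (hp : ∀ ω, 0 ≤ p ω) (T : Ω → τ)
    (X : Ω → α) : HH (cpm p T) (fun q => X q.2) = HH p X := by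
  have : ∀ q, prb (cpm p T) (fun q => X q.2) q = prb p X q.2 := fun q => by
    rw [prb_eq_mul, prb_eq_mul]
    exact cpm_sum_snd hp T (fun w => if X w = X q.2 then 1 else 0)
  unfold HH
  simp only [this]
  exact cpm_sum_snd hp T (fun w => -Real.log (prb p X w))

lemma cpm_T {Ω τ : Type*} [Fintype Ω] {p : Ω → ℝ} {T : Ω → τ} {q : Ω × Ω}
    (h : cpm p T q ≠ 0) : T q.2 = T q.1 := by
  by_contra hc
  exact h (if_neg hc)

lemma HH_indep {Ω τ α β : Type*} [Fintype Ω] {p : Ω → ℝ} (hp : ∀ ω, 0 ≤ p ω) (T : Ω → τ)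
    (V : Ω → α) (U : Ω → β) :
    HH (cpm p T) (fun q => (V q.1, U q.2, T q.1)) =
      HH p (fun ω => (U ω, T ω)) + HH p (fun ω => (V ω, T ω)) - HH p T := by
  have hpr : ∀ q, cpm p T q ≠ 0 →
      prb (cpm p T) (fun q => (V q.1, U q.2, T q.1)) q =
        prb p (fun ω => (V ω, T ω)) q.1 * prb p (fun ω => (U ω, T ω)) q.2 / prb p T q.1 := by
    rintro ⟨a, b⟩ hq
    have hT : T b = T a := cpm_T hq
    unfold prb
    rw [Fintype.sum_prod_type, Finset.sum_mul_sum, Finset.sum_div]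
    refine Finset.sum_congr rfl fun a' _ => ?_
    rw [Finset.sum_div]
    refine Finset.sum_congr rfl fun b' _ => ?_
    simp only [Prod.mk.injEq, cpm]
    by_cases h1 : V a' = V a ∧ T a' = T a
    · by_cases h2 : U b' = U b ∧ T b' = T b
      · have h3 : T b' = T a' := by rw [h2.2, hT, h1.2]
        rw [if_pos ⟨h1.1, h2.1, h1.2⟩, if_pos h3, if_pos h1, if_pos h2, prb_eq_of_eq p T h1.2]
        rfl
      · rw [if_neg h2]
        have : ¬ ((V a' = V a ∧ U b' = U b ∧ T a' = T a) ∧ T b' = T a') := by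
          rintro ⟨⟨_, g2, g3⟩, g4⟩
          exact h2 ⟨g2, by rw [g4, g3, hT]⟩
        by_cases g : V a' = V a ∧ U b' = U b ∧ T a' = T a
        · rw [if_pos g, if_neg (fun g4 => this ⟨g, g4⟩)]; simp
        · rw [if_neg g]; simp
    · rw [if_neg h1, if_neg (fun g => h1 ⟨g.1, g.2.2⟩)]; simp
  have hpt : ∀ q, cpm p T q * -Real.log (prb (cpm p T) (fun q => (V q.1, U q.2, T q.1)) q) =
      cpm p T q * -Real.log (prb p (fun ω => (U ω, T ω)) q.2) +
      cpm p T q * -Real.log (prb p (fun ω => (V ω, T ω)) q.1) -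
      cpm p T q * -Real.log (prb p T q.1) := by
    intro q
    by_cases hq : cpm p T q = 0
    · simp [hq]
    have h12 : p q.1 ≠ 0 ∧ p q.2 ≠ 0 := by
      constructor <;> intro h <;> apply hq <;> simp [cpm, h]
    rw [hpr q hq, Real.log_div (mul_pos (prb_pos hp _ h12.1) (prb_pos hp _ h12.2)).ne'
      (prb_pos hp _ h12.1).ne', Real.log_mul (prb_pos hp _ h12.1).ne' (prb_pos hp _ h12.2).ne']
    ring
  have e : HH (cpm p T) (fun q => (V q.1, U q.2, T q.1)) =
      ∑ q, cpm p T q * -Real.log (prb (cpm p T) (fun q => (V q.1, U q.2, T q.1)) q) := rfl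
  rw [e, Finset.sum_congr rfl fun q _ => hpt q, Finset.sum_sub_distrib, Finset.sum_add_distrib,
    cpm_sum_snd hp T (fun w => -Real.log (prb p (fun ω => (U ω, T ω)) w)),
    cpm_sum_fst hp T (fun w => -Real.log (prb p (fun ω => (V ω, T ω)) w)),
    cpm_sum_fst hp T (fun w => -Real.log (prb p T w))]
  rfl

/-! ### Entropy set functions -/

/-- `h` is the entropy function of a sequence of random variables. -/
def IsEnt (h : Finset ℕ → ℝ) : Prop :=
  ∃ (Ω : Type) (_ : Fintype Ω) (κ : Type) (p : Ω → ℝ) (X : ℕ → Ω → κ),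
    (∀ ω, 0 ≤ p ω) ∧ (∑ ω, p ω = 1) ∧
    ∀ s : Finset ℕ, h s = HH p (fun ω => fun i : s => X i ω)

lemma tup_eq {Ω κ : Type*} (X : ℕ → Ω → κ) (s : Finset ℕ) (ω ω' : Ω) :
    ((fun i : s => X i ω) = (fun i : s => X i ω')) ↔ ∀ i ∈ s, X i ω = X i ω' := by
  constructor
  · intro h i hi
    exact congrFun h ⟨i, hi⟩
  · intro h
    funext i
    exact h i i.2

lemma IsEnt.empty {h : Finset ℕ → ℝ} (hE : IsEnt h) : h ∅ = 0 := by
  obtain ⟨Ω, _, κ, p, X, hp, hs, hh⟩ := hE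
  rw [hh]
  refine HH_const hs _ fun ω ω' => ?_
  rw [tup_eq]; simp

lemma IsEnt.mono {h : Finset ℕ → ℝ} (hE : IsEnt h) {s t : Finset ℕ} (hst : s ⊆ t) :
    h s ≤ h t := by
  obtain ⟨Ω, _, κ, p, X, hp, hs, hh⟩ := hE
  rw [hh, hh]
  refine HH_mono hp _ _ fun ω ω' => ?_
  rw [tup_eq, tup_eq]
  exact fun g i hi => g i (hst hi)

lemma IsEnt.submod {h : Finset ℕ → ℝ} (hE : IsEnt h) {s t u v : Finset ℕ}
    (hu : u = s ∪ t) (hv : v = s ∩ t) : h u + h v ≤ h s + h t := by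
  obtain ⟨Ω, _, κ, p, X, hp, hs, hh⟩ := hE
  subst hu hv
  simp only [hh]
  have := HH_submod hp hs (fun ω => fun i : s => X i ω) (fun ω => fun i : t => X i ω)
    (fun ω => fun i : (s ∩ t : Finset ℕ) => X i ω)
  refine le_trans (le_of_eq ?_) (this.trans (le_of_eq ?_))
  · congr 1
    refine HH_congr p _ _ fun ω ω' _ _ => ?_
    simp only [Prod.mk.injEq, tup_eq, Finset.mem_union, Finset.mem_inter]
    grind
  · congr 1
    all_goals
      refine HH_congr p _ _ fun ω ω' _ _ => ?_
      simp only [Prod.mk.injEq, tup_eq, Finset.mem_inter]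
      grind

/-- The variables indexed by `N` are a copy (along `c`) over `T`, conditionally independent
of the variables with index below `M`. -/
structure CopyProp (h : Finset ℕ → ℝ) (M : ℕ) (N T : Finset ℕ) (c : ℕ → ℕ) : Prop where
  copy : ∀ s t w w' : Finset ℕ, s ⊆ N → t ⊆ T → w = s ∪ t → w' = s.image c ∪ t → h w = h w'
  indep : ∀ s R w a : Finset ℕ, s ⊆ N → T ⊆ R → R ⊆ Finset.range M → w = s ∪ R →
    a = s.image c ∪ T → h w = h a + h R - h T

lemma copy_step_s9 {h : Finset ℕ → ℝ} (hE : IsEnt h) (M : ℕ) (N T : Finset ℕ) (c : ℕ → ℕ)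
    (hN : ∀ i ∈ N, M ≤ i) (hT : T ⊆ Finset.range M) (hc : ∀ i ∈ N, c i < M) :
    ∃ h', IsEnt h' ∧ CopyProp h' M N T c ∧ ∀ s ⊆ Finset.range M, h' s = h s := by
  obtain ⟨Ω, _, κ, p, X, hp, hs, hh⟩ := hE
  set Tv : Ω → (T → κ) := fun ω => fun i : T => X i ω with hTv
  set X' : ℕ → Ω × Ω → κ := fun i q => if i ∈ N then X (c i) q.2 else X i q.1 with hX'
  have hX1 : ∀ i, i < M → ∀ q, X' i q = X i q.1 := by
    intro i hi q
    exact if_neg (fun hiN => absurd (hN i hiN) (not_le.2 hi))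
  have hX2 : ∀ i ∈ N, ∀ q, X' i q = X (c i) q.2 := fun i hi q => if_pos hi
  have hTq : ∀ q, cpm p Tv q ≠ 0 → ∀ i ∈ T, X i q.2 = X i q.1 := fun q hq =>
    (tup_eq X T q.2 q.1).1 (cpm_T hq)
  have hTM : ∀ i ∈ T, i < M := fun i hi => Finset.mem_range.1 (hT hi)
  have hlow : ∀ s ⊆ Finset.range M, HH (cpm p Tv) (fun q => fun i : s => X' i q) = h s := by
    intro s hsM
    rw [hh, ← HH_fst hp Tv]
    refine HH_congr _ _ _ fun q q' _ _ => ?_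
    rw [tup_eq, tup_eq X s q.1 q'.1]
    refine forall₂_congr fun i hi => ?_
    rw [hX1 i (Finset.mem_range.1 (hsM hi)), hX1 i (Finset.mem_range.1 (hsM hi))]
  have hcM : ∀ s ⊆ N, ∀ t ⊆ T, s.image c ∪ t ⊆ Finset.range M := by
    intro s hsN t htT
    refine Finset.union_subset (fun i hi => ?_) (htT.trans hT)
    obtain ⟨j, hj, rfl⟩ := Finset.mem_image.1 hi
    exact Finset.mem_range.2 (hc j (hsN hj))
  refine ⟨fun s => HH (cpm p Tv) (fun q => fun i : s => X' i q),
    ⟨Ω × Ω, inferInstance, κ, cpm p Tv, X', cpm_nonneg hp Tv, by rw [cpm_sum hp, hs],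
      fun s => rfl⟩, ⟨?_, ?_⟩, hlow⟩
  · intro s t w w' hsN htT hw hw'
    subst hw hw'
    rw [hlow _ (hcM s hsN t htT), hh, ← HH_snd hp Tv]
    refine HH_congr _ _ _ fun q q' hq hq' => ?_
    rw [tup_eq, tup_eq X _ q.2 q'.2]
    simp only [Finset.mem_union, Finset.mem_image, or_imp, forall_and, forall_exists_index,
      and_imp, forall_apply_eq_imp_iff₂]
    refine and_congr (forall₂_congr fun i hi => ?_) (forall₂_congr fun i hi => ?_)
    · rw [hX2 i (hsN hi), hX2 i (hsN hi)]
    · rw [hX1 i (hTM i (htT hi)), hX1 i (hTM i (htT hi)), hTq q hq i (htT hi),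
        hTq q' hq' i (htT hi)]
  · intro s R w a hsN hTR hR hw ha
    subst hw ha
    rw [hlow _ (hcM s hsN T subset_rfl), hlow R hR, hlow T hT]
    have key := HH_indep hp Tv (fun ω => fun i : R => X i ω)
      (fun ω => fun i : s.image c => X i ω)
    have e1 : HH p (fun ω => ((fun i : s.image c => X i ω), Tv ω)) = h (s.image c ∪ T) := by
      rw [hh]
      refine HH_congr _ _ _ fun q q' _ _ => ?_
      simp only [hTv, Prod.mk.injEq, tup_eq, Finset.mem_union, or_imp, forall_and]
    have e2 : HH p (fun ω => ((fun i : R => X i ω), Tv ω)) = h R := by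
      rw [hh]
      refine HH_congr _ _ _ fun q q' _ _ => ?_
      simp only [hTv, Prod.mk.injEq, tup_eq]
      exact ⟨fun g => g.1, fun g => ⟨g, fun i hi => g i (hTR hi)⟩⟩
    have e3 : HH p Tv = h T := (hh T).symm
    rw [e1, e2, e3] at key
    rw [← key]
    refine HH_congr _ _ _ fun q q' _ _ => ?_
    have f1 := tup_eq X R q.1 q'.1
    have f2 := tup_eq X (s.image c) q.2 q'.2
    have f3 := tup_eq X T q.1 q'.1
    rw [tup_eq, Prod.mk.injEq, Prod.mk.injEq, f1, f2, hTv, f3]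
    simp only [Finset.mem_union, Finset.mem_image, or_imp, forall_and, forall_exists_index,
      and_imp, forall_apply_eq_imp_iff₂]
    have g1 : (∀ i ∈ s, X' i q = X' i q') ↔ ∀ i ∈ s, X (c i) q.2 = X (c i) q'.2 :=
      forall₂_congr fun i hi => by rw [hX2 i (hsN hi), hX2 i (hsN hi)]
    have g2 : (∀ i ∈ R, X' i q = X' i q') ↔ ∀ i ∈ R, X i q.1 = X i q'.1 :=
      forall₂_congr fun i hi => by
        rw [hX1 i (Finset.mem_range.1 (hR hi)), hX1 i (Finset.mem_range.1 (hR hi))]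
    rw [g1, g2]
    exact ⟨fun g => ⟨g.2, g.1, fun i hi => g.2 i (hTR hi)⟩, fun g => ⟨g.2.1, g.1⟩⟩

lemma CopyProp.congr {h h' : Finset ℕ → ℝ} {M : ℕ} {N T : Finset ℕ} {c : ℕ → ℕ}
    (hC : CopyProp h M N T c) (M' : ℕ) (hMM : M ≤ M') (hN : N ⊆ Finset.range M')
    (hT : T ⊆ Finset.range M) (hc : ∀ i ∈ N, c i < M)
    (heq : ∀ s ⊆ Finset.range M', h' s = h s) : CopyProp h' M N T c := by
  have hr : Finset.range M ⊆ Finset.range M' := Finset.range_subset_range.2 hMM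
  have him : ∀ s ⊆ N, s.image c ⊆ Finset.range M' := by
    intro s hs i hi
    obtain ⟨j, hj, rfl⟩ := Finset.mem_image.1 hi
    exact hr (Finset.mem_range.2 (hc j (hs hj)))
  constructor
  · intro s t w w' hs ht hw hw'
    have ht' := ht.trans (hT.trans hr)
    rw [heq w (hw ▸ Finset.union_subset (hs.trans hN) ht'),
      heq w' (hw' ▸ Finset.union_subset (him s hs) ht')]
    exact hC.copy s t w w' hs ht hw hw'
  · intro s R w a hs hTR hR hw ha
    rw [heq w (hw ▸ Finset.union_subset (hs.trans hN) (hR.trans hr)),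
      heq a (ha ▸ Finset.union_subset (him s hs) (hT.trans hr)), heq R (hR.trans hr),
      heq T (hT.trans hr)]
    exact hC.indep s R w a hs hTR hR hw ha

/-- The index of the variable of which a new variable is a copy. -/
def cp (i : ℕ) : ℕ :=
  if i = 4 then 0 else if i = 5 then 2 else if i = 6 then 3 else if i = 7 then 4 else i

lemma extend {h0 : Finset ℕ → ℝ} (hE0 : IsEnt h0) :
    ∃ h, IsEnt h ∧ CopyProp h 4 {4, 5} {1, 3} cp ∧ CopyProp h 6 {6} {1, 2, 4} cp ∧
      CopyProp h 7 {7} {1, 3, 6} cp ∧ ∀ s ⊆ Finset.range 4, h s = h0 s := by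
  obtain ⟨h1, hE1, c1, g1⟩ := copy_step_s9 hE0 4 {4, 5} {1, 3} cp (by decide) (by decide) (by decide)
  obtain ⟨h2, hE2, c2, g2⟩ := copy_step_s9 hE1 6 {6} {1, 2, 4} cp (by decide) (by decide) (by decide)
  obtain ⟨h3, hE3, c3, g3⟩ := copy_step_s9 hE2 7 {7} {1, 3, 6} cp (by decide) (by decide) (by decide)
  have r46 : Finset.range 4 ⊆ Finset.range 6 := by decide
  have r67 : Finset.range 6 ⊆ Finset.range 7 := by decide
  have g31 : ∀ s ⊆ Finset.range 6, h3 s = h1 s := fun s hs => by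
    rw [g3 s (hs.trans r67), g2 s hs]
  refine ⟨h3, hE3, ?_, ?_, c3, fun s hs => ?_⟩
  · exact c1.congr 6 (by decide) (by decide) (by decide) (by decide) g31
  · exact c2.congr 7 (by decide) (by decide) (by decide) (by decide) g3
  · rw [g31 s (hs.trans r46), g1 s hs]

lemma IsEntropic.toEnt {x : EIndex 4 → ℝ} (hx : IsEntropic x) (σ : Equiv.Perm (Fin 4)) :
    ∃ h : Finset ℕ → ℝ, IsEnt h ∧
      ∀ (V : EIndex 4) (s : Finset ℕ), s = V.1.image (fun i => (σ i).val) → h s = x V := by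
  obtain ⟨m, k, p, hp, hs, X, hX⟩ := hx
  refine ⟨fun s => HH p (fun ω => fun i : s => X (σ.symm (Fin.ofNat 4 i)) ω),
    ⟨Fin m, inferInstance, Fin k, p, fun i => X (σ.symm (Fin.ofNat 4 i)), hp, hs, fun s => rfl⟩,
    fun V s hVs => ?_⟩
  subst hVs
  rw [hX, ent_eq_HH]
  refine HH_congr _ _ _ fun ω ω' _ _ => ?_
  rw [tup_eq (fun i => X (σ.symm (Fin.ofNat 4 i)))]
  simp only [Finset.mem_image, forall_exists_index, and_imp, forall_apply_eq_imp_iff₂]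
  constructor
  · intro g
    funext i
    have := g i.1 i.2
    simpa using this
  · intro g i hi
    have := congrFun g ⟨i, hi⟩
    simpa using this

/-- Asymmetric four-variable inequality obtained from three copy steps. -/
lemma asym_aux {h : Finset ℕ → ℝ} (hE : IsEnt h)
    (c0 : CopyProp h 4 {4, 5} {1, 3} cp) (c1 : CopyProp h 6 {6} {1, 2, 4} cp)
    (c2 : CopyProp h 7 {7} {1, 3, 6} cp) :
    0 ≤ (-17) * h {0} + (-21) * h {1} + (19) * h {0, 1} + (3) * h {2} + (9) * h {0, 2} + (17) * h {1, 2} + (-7) * h {0, 1, 2} + (-3) * h {3} + (23) * h {0, 3} + (27) * h {1, 3} + (-31) * h {0, 1, 3} + (-19) * h {2, 3} + (7) * h {0, 2, 3} + (-7) * h {1, 2, 3} + (3) * h {0, 1, 2, 3} := by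
  have e0 := IsEnt.mono hE (s := {1, 2, 3, 4, 5, 6, 7}) (t := {0, 1, 2, 3, 4, 5, 6, 7}) (by decide)
  have e1 := IsEnt.mono hE (s := {0, 1, 2, 3, 4, 6, 7}) (t := {0, 1, 2, 3, 4, 5, 6, 7}) (by decide)
  have e2 := IsEnt.submod hE (s := {0, 2, 3}) (t := {1, 2, 3}) (u := {0, 1, 2, 3}) (v := {2, 3}) (by decide) (by decide)
  have e3 := IsEnt.submod hE (s := {0, 2, 6}) (t := {1, 2, 6}) (u := {0, 1, 2, 6}) (v := {2, 6}) (by decide) (by decide)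
  have e4 := IsEnt.submod hE (s := {0, 3}) (t := {3, 4}) (u := {0, 3, 4}) (v := {3}) (by decide) (by decide)
  have e5 := IsEnt.submod hE (s := {0, 1, 3, 6}) (t := {1, 3, 4, 6}) (u := {0, 1, 3, 4, 6}) (v := {1, 3, 6}) (by decide) (by decide)
  have e6 := IsEnt.submod hE (s := {0, 1}) (t := {1, 6}) (u := {0, 1, 6}) (v := {1}) (by decide) (by decide)
  have e7 := IsEnt.submod hE (s := {0, 4}) (t := {4, 6}) (u := {0, 4, 6}) (v := {4}) (by decide) (by decide)
  have e8 := IsEnt.submod hE (s := {0, 1, 4}) (t := {0, 3, 4}) (u := {0, 1, 3, 4}) (v := {0, 4}) (by decide) (by decide)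
  have e9 := IsEnt.submod hE (s := {1, 4, 6, 7}) (t := {3, 4, 6, 7}) (u := {1, 3, 4, 6, 7}) (v := {4, 6, 7}) (by decide) (by decide)
  have e10 := IsEnt.submod hE (s := {0, 1, 6}) (t := {0, 4, 6}) (u := {0, 1, 4, 6}) (v := {0, 6}) (by decide) (by decide)
  have e11 := IsEnt.submod hE (s := {1, 3, 6}) (t := {3, 4, 6}) (u := {1, 3, 4, 6}) (v := {3, 6}) (by decide) (by decide)
  have e12 := IsEnt.submod hE (s := {1, 5, 6}) (t := {4, 5, 6}) (u := {1, 4, 5, 6}) (v := {5, 6}) (by decide) (by decide)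
  have e13 := IsEnt.submod hE (s := {1, 3, 5, 6}) (t := {3, 4, 5, 6}) (u := {1, 3, 4, 5, 6}) (v := {3, 5, 6}) (by decide) (by decide)
  have e14 := IsEnt.submod hE (s := {1, 5, 7}) (t := {4, 5, 7}) (u := {1, 4, 5, 7}) (v := {5, 7}) (by decide) (by decide)
  have e15 := IsEnt.submod hE (s := {1, 3, 5}) (t := {3, 5, 6}) (u := {1, 3, 5, 6}) (v := {3, 5}) (by decide) (by decide)
  have e16 := IsEnt.submod hE (s := {1, 4, 7}) (t := {4, 6, 7}) (u := {1, 4, 6, 7}) (v := {4, 7}) (by decide) (by decide)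
  have e17 := IsEnt.submod hE (s := {1, 3, 5, 6}) (t := {3, 5, 6, 7}) (u := {1, 3, 5, 6, 7}) (v := {3, 5, 6}) (by decide) (by decide)
  have e18 := IsEnt.submod hE (s := {2}) (t := {3}) (u := {2, 3}) (v := ∅) (by decide) (by decide)
  have e19 := IsEnt.submod hE (s := {0, 2}) (t := {0, 3}) (u := {0, 2, 3}) (v := {0}) (by decide) (by decide)
  have e20 := IsEnt.submod hE (s := {1, 2, 4, 6}) (t := {1, 3, 4, 6}) (u := {1, 2, 3, 4, 6}) (v := {1, 4, 6}) (by decide) (by decide)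
  have e21 := IsEnt.submod hE (s := {1, 2}) (t := {1, 4}) (u := {1, 2, 4}) (v := {1}) (by decide) (by decide)
  have e22 := IsEnt.submod hE (s := {0, 1, 2, 3, 6}) (t := {0, 1, 3, 4, 6}) (u := {0, 1, 2, 3, 4, 6}) (v := {0, 1, 3, 6}) (by decide) (by decide)
  have e23 := IsEnt.submod hE (s := {0, 2}) (t := {0, 6}) (u := {0, 2, 6}) (v := {0}) (by decide) (by decide)
  have e24 := IsEnt.submod hE (s := {0, 1, 2, 4}) (t := {0, 1, 4, 6}) (u := {0, 1, 2, 4, 6}) (v := {0, 1, 4}) (by decide) (by decide)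
  have e25 := IsEnt.submod hE (s := {1, 2, 4, 5}) (t := {1, 4, 5, 6}) (u := {1, 2, 4, 5, 6}) (v := {1, 4, 5}) (by decide) (by decide)
  have e26 := IsEnt.submod hE (s := {1, 2, 3, 4, 5}) (t := {1, 3, 4, 5, 6}) (u := {1, 2, 3, 4, 5, 6}) (v := {1, 3, 4, 5}) (by decide) (by decide)
  have e27 := IsEnt.submod hE (s := {3, 6}) (t := {5, 6}) (u := {3, 5, 6}) (v := {6}) (by decide) (by decide)
  have e28 := IsEnt.submod hE (s := {3, 7}) (t := {5, 7}) (u := {3, 5, 7}) (v := {7}) (by decide) (by decide)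
  have e29 := IsEnt.submod hE (s := {0, 1, 2, 3}) (t := {0, 1, 2, 6}) (u := {0, 1, 2, 3, 6}) (v := {0, 1, 2}) (by decide) (by decide)
  have e30 := IsEnt.submod hE (s := {3, 4}) (t := {4, 6}) (u := {3, 4, 6}) (v := {4}) (by decide) (by decide)
  have e31 := IsEnt.submod hE (s := {1, 3, 4, 5, 6}) (t := {1, 4, 5, 6, 7}) (u := {1, 3, 4, 5, 6, 7}) (v := {1, 4, 5, 6}) (by decide) (by decide)
  have e32 := IsEnt.submod hE (s := {3, 4, 5}) (t := {3, 5, 6}) (u := {3, 4, 5, 6}) (v := {3, 5}) (by decide) (by decide)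
  have e33 := IsEnt.submod hE (s := {1, 4, 6}) (t := {1, 6, 7}) (u := {1, 4, 6, 7}) (v := {1, 6}) (by decide) (by decide)
  have e34 := IsEnt.submod hE (s := {3, 4, 6}) (t := {3, 6, 7}) (u := {3, 4, 6, 7}) (v := {3, 6}) (by decide) (by decide)
  have e35 := IsEnt.submod hE (s := {1, 5}) (t := {1, 6}) (u := {1, 5, 6}) (v := {1}) (by decide) (by decide)
  have e36 := IsEnt.submod hE (s := {4, 5}) (t := {4, 6}) (u := {4, 5, 6}) (v := {4}) (by decide) (by decide)
  have e37 := IsEnt.submod hE (s := {1, 4, 5, 7}) (t := {1, 4, 6, 7}) (u := {1, 4, 5, 6, 7}) (v := {1, 4, 7}) (by decide) (by decide)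
  have e38 := IsEnt.submod hE (s := {1, 5}) (t := {1, 7}) (u := {1, 5, 7}) (v := {1}) (by decide) (by decide)
  have e39 := IsEnt.submod hE (s := {4, 5}) (t := {4, 7}) (u := {4, 5, 7}) (v := {4}) (by decide) (by decide)
  have e40 := IsEnt.submod hE (s := {3, 5, 6}) (t := {3, 5, 7}) (u := {3, 5, 6, 7}) (v := {3, 5}) (by decide) (by decide)
  have q0 := c2.indep {7} {0, 1, 2, 3, 4, 5, 6} {0, 1, 2, 3, 4, 5, 6, 7} {1, 3, 4, 6} (by decide) (by decide) (by decide) (by decide) (by decide)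
  have q1 := c2.indep {7} {1, 2, 3, 4, 5, 6} {1, 2, 3, 4, 5, 6, 7} {1, 3, 4, 6} (by decide) (by decide) (by decide) (by decide) (by decide)
  have q2 := c2.indep {7} {1, 3, 4, 5, 6} {1, 3, 4, 5, 6, 7} {1, 3, 4, 6} (by decide) (by decide) (by decide) (by decide) (by decide)
  have q3 := c2.indep {7} {1, 3, 5, 6} {1, 3, 5, 6, 7} {1, 3, 4, 6} (by decide) (by decide) (by decide) (by decide) (by decide)
  have q4 := c2.indep {7} {0, 1, 2, 3, 4, 6} {0, 1, 2, 3, 4, 6, 7} {1, 3, 4, 6} (by decide) (by decide) (by decide) (by decide) (by decide)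
  have q5 := c2.indep {7} {1, 3, 4, 6} {1, 3, 4, 6, 7} {1, 3, 4, 6} (by decide) (by decide) (by decide) (by decide) (by decide)
  have q6 := c2.copy {7} {3, 6} {3, 6, 7} {3, 4, 6} (by decide) (by decide) (by decide) (by decide)
  have q7 := c2.copy {7} {1, 6} {1, 6, 7} {1, 4, 6} (by decide) (by decide) (by decide) (by decide)
  have q8 := c2.copy {7} {3} {3, 7} {3, 4} (by decide) (by decide) (by decide) (by decide)
  have q9 := c2.copy {7} {1} {1, 7} {1, 4} (by decide) (by decide) (by decide) (by decide)
  have q10 := c2.copy {7} ∅ {7} {4} (by decide) (by decide) (by decide) (by decide)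
  have q11 := c1.indep {6} {0, 1, 2, 3, 4, 5} {0, 1, 2, 3, 4, 5, 6} {1, 2, 3, 4} (by decide) (by decide) (by decide) (by decide) (by decide)
  have q12 := c1.indep {6} {1, 2, 3, 4, 5} {1, 2, 3, 4, 5, 6} {1, 2, 3, 4} (by decide) (by decide) (by decide) (by decide) (by decide)
  have q13 := c1.indep {6} {1, 2, 4, 5} {1, 2, 4, 5, 6} {1, 2, 3, 4} (by decide) (by decide) (by decide) (by decide) (by decide)
  have q14 := c1.indep {6} {0, 1, 2, 3, 4} {0, 1, 2, 3, 4, 6} {1, 2, 3, 4} (by decide) (by decide) (by decide) (by decide) (by decide)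
  have q15 := c1.indep {6} {1, 2, 3, 4} {1, 2, 3, 4, 6} {1, 2, 3, 4} (by decide) (by decide) (by decide) (by decide) (by decide)
  have q16 := c1.indep {6} {0, 1, 2, 4} {0, 1, 2, 4, 6} {1, 2, 3, 4} (by decide) (by decide) (by decide) (by decide) (by decide)
  have q17 := c1.copy {6} {1, 2, 4} {1, 2, 4, 6} {1, 2, 3, 4} (by decide) (by decide) (by decide) (by decide)
  have q18 := c1.copy {6} {1, 4} {1, 4, 6} {1, 3, 4} (by decide) (by decide) (by decide) (by decide)
  have q19 := c1.copy {6} {4} {4, 6} {3, 4} (by decide) (by decide) (by decide) (by decide)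
  have q20 := c1.copy {6} {1, 2} {1, 2, 6} {1, 2, 3} (by decide) (by decide) (by decide) (by decide)
  have q21 := c1.copy {6} {2} {2, 6} {2, 3} (by decide) (by decide) (by decide) (by decide)
  have q22 := c1.copy {6} {1} {1, 6} {1, 3} (by decide) (by decide) (by decide) (by decide)
  have q23 := c1.copy {6} ∅ {6} {3} (by decide) (by decide) (by decide) (by decide)
  have q24 := c0.indep {4, 5} {0, 1, 2, 3} {0, 1, 2, 3, 4, 5} {0, 1, 2, 3} (by decide) (by decide) (by decide) (by decide) (by decide)
  have q25 := c0.indep {4, 5} {1, 2, 3} {1, 2, 3, 4, 5} {0, 1, 2, 3} (by decide) (by decide) (by decide) (by decide) (by decide)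
  have q26 := c0.copy {4, 5} {1, 3} {1, 3, 4, 5} {0, 1, 2, 3} (by decide) (by decide) (by decide) (by decide)
  have q27 := c0.copy {4, 5} {3} {3, 4, 5} {0, 2, 3} (by decide) (by decide) (by decide) (by decide)
  have q28 := c0.copy {4, 5} {1} {1, 4, 5} {0, 1, 2} (by decide) (by decide) (by decide) (by decide)
  have q29 := c0.copy {4, 5} ∅ {4, 5} {0, 2} (by decide) (by decide) (by decide) (by decide)
  have q30 := c0.copy {5} {1, 3} {1, 3, 5} {1, 2, 3} (by decide) (by decide) (by decide) (by decide)
  have q31 := c0.copy {5} {3} {3, 5} {2, 3} (by decide) (by decide) (by decide) (by decide)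
  have q32 := c0.copy {5} {1} {1, 5} {1, 2} (by decide) (by decide) (by decide) (by decide)
  have q33 := c0.indep {4} {0, 1, 2, 3} {0, 1, 2, 3, 4} {0, 1, 3} (by decide) (by decide) (by decide) (by decide) (by decide)
  have q34 := c0.indep {4} {1, 2, 3} {1, 2, 3, 4} {0, 1, 3} (by decide) (by decide) (by decide) (by decide) (by decide)
  have q35 := c0.indep {4} {0, 1, 3} {0, 1, 3, 4} {0, 1, 3} (by decide) (by decide) (by decide) (by decide) (by decide)
  have q36 := c0.copy {4} {1, 3} {1, 3, 4} {0, 1, 3} (by decide) (by decide) (by decide) (by decide)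
  have q37 := c0.copy {4} {3} {3, 4} {0, 3} (by decide) (by decide) (by decide) (by decide)
  have q38 := c0.copy {4} {1} {1, 4} {0, 1} (by decide) (by decide) (by decide) (by decide)
  have q39 := c0.copy {4} ∅ {4} {0} (by decide) (by decide) (by decide) (by decide)
  have q40 := IsEnt.empty hE
  linear_combination 6 * e0 + 6 * e1 + 7 * e2 + 4 * e3 + 4 * e4 + 4 * e5 + 4 * e6 + 4 * e7 + 4 * e8 + 1 * e9 + 4 * e10 + 1 * e11 + 2 * e12 + 2 * e13 + 1 * e14 + 2 * e15 + 1 * e16 + 1 * e17 + 3 * e18 + 2 * e19 + 1 * e20 + 14 * e21 + 4 * e22 + 4 * e23 + 4 * e24 + 3 * e25 + 2 * e26 + 2 * e27 + 1 * e28 + 4 * e29 + 3 * e30 + 1 * e31 + 2 * e32 + 1 * e33 + 1 * e34 + 2 * e35 + 2 * e36 + 1 * e37 + 1 * e38 + 1 * e39 + 1 * e40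
    + (12) * q0 + (-6) * q1 + (-1) * q2 + (-1) * q3 + (-6) * q4 + (-1) * q5 + (1) * q6 + (1) * q7 + (1) * q8 + (1) * q9 + (-1) * q10 + (12) * q11 + (-8) * q12 + (-3) * q13 + (-10) * q14 + (-1) * q15 + (-4) * q16 + (1) * q17 + (1) * q18 + (9) * q19 + (4) * q20 + (-4) * q21 + (5) * q22 + (-2) * q23 + (12) * q24 + (-6) * q25 + (-2) * q26 + (2) * q27 + (-3) * q28 + (3) * q29 + (2) * q30 + (-5) * q31 + (3) * q32 + (-10) * q33 + (-14) * q34 + (-4) * q35 + (1) * q36 + (17) * q37 + (15) * q38 + (-11) * q39 + (-3) * q40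

/-- The asymmetric inequality for an entropic point, in the coordinates permuted by `σ`. -/
lemma asym_point {x : EIndex 4 → ℝ} (hx : IsEntropic x) (σ : Equiv.Perm (Fin 4)) :
    ∃ h : Finset ℕ → ℝ, IsEnt h ∧
      (∀ (V : EIndex 4) (s : Finset ℕ), s = V.1.image (fun i => (σ i).val) → h s = x V) ∧
    0 ≤ (-17) * h {0} + (-21) * h {1} + (19) * h {0, 1} + (3) * h {2} + (9) * h {0, 2} + (17) * h {1, 2} + (-7) * h {0, 1, 2} + (-3) * h {3} + (23) * h {0, 3} + (27) * h {1, 3} + (-31) * h {0, 1, 3} + (-19) * h {2, 3} + (7) * h {0, 2, 3} + (-7) * h {1, 2, 3} + (3) * h {0, 1, 2, 3} := by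
  obtain ⟨h0, hE0, hv⟩ := hx.toEnt σ
  obtain ⟨h, hE, c0, c1, c2, hh⟩ := extend hE0
  refine ⟨h, hE, fun V s hs => ?_, asym_aux hE c0 c1 c2⟩
  rw [hh s, hv V s hs]
  subst hs
  intro j hj
  simp only [Finset.mem_image] at hj
  obtain ⟨i, -, rfl⟩ := hj
  simp

lemma entropic_bound {x : EIndex 4 → ℝ} (hx : IsEntropic x) :
    0 ≤ Ing4 x + (3 / 19) * x ⟨{0, 1, 2, 3}, by decide⟩ := by
  obtain ⟨h0, -, v0, i0⟩ := asym_point hx (Equiv.refl _)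
  rw [v0 ⟨{0}, by decide⟩ {0} (by decide),
    v0 ⟨{1}, by decide⟩ {1} (by decide),
    v0 ⟨{0, 1}, by decide⟩ {0, 1} (by decide),
    v0 ⟨{2}, by decide⟩ {2} (by decide),
    v0 ⟨{0, 2}, by decide⟩ {0, 2} (by decide),
    v0 ⟨{1, 2}, by decide⟩ {1, 2} (by decide),
    v0 ⟨{0, 1, 2}, by decide⟩ {0, 1, 2} (by decide),
    v0 ⟨{3}, by decide⟩ {3} (by decide),
    v0 ⟨{0, 3}, by decide⟩ {0, 3} (by decide),
    v0 ⟨{1, 3}, by decide⟩ {1, 3} (by decide),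
    v0 ⟨{0, 1, 3}, by decide⟩ {0, 1, 3} (by decide),
    v0 ⟨{2, 3}, by decide⟩ {2, 3} (by decide),
    v0 ⟨{0, 2, 3}, by decide⟩ {0, 2, 3} (by decide),
    v0 ⟨{1, 2, 3}, by decide⟩ {1, 2, 3} (by decide),
    v0 ⟨{0, 1, 2, 3}, by decide⟩ {0, 1, 2, 3} (by decide)] at i0
  obtain ⟨h1, -, v1, i1⟩ := asym_point hx (Equiv.swap 0 1)
  rw [v1 ⟨{1}, by decide⟩ {0} (by decide),
    v1 ⟨{0}, by decide⟩ {1} (by decide),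
    v1 ⟨{0, 1}, by decide⟩ {0, 1} (by decide),
    v1 ⟨{2}, by decide⟩ {2} (by decide),
    v1 ⟨{1, 2}, by decide⟩ {0, 2} (by decide),
    v1 ⟨{0, 2}, by decide⟩ {1, 2} (by decide),
    v1 ⟨{0, 1, 2}, by decide⟩ {0, 1, 2} (by decide),
    v1 ⟨{3}, by decide⟩ {3} (by decide),
    v1 ⟨{1, 3}, by decide⟩ {0, 3} (by decide),
    v1 ⟨{0, 3}, by decide⟩ {1, 3} (by decide),
    v1 ⟨{0, 1, 3}, by decide⟩ {0, 1, 3} (by decide),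
    v1 ⟨{2, 3}, by decide⟩ {2, 3} (by decide),
    v1 ⟨{1, 2, 3}, by decide⟩ {0, 2, 3} (by decide),
    v1 ⟨{0, 2, 3}, by decide⟩ {1, 2, 3} (by decide),
    v1 ⟨{0, 1, 2, 3}, by decide⟩ {0, 1, 2, 3} (by decide)] at i1
  obtain ⟨h2, -, v2, i2⟩ := asym_point hx (Equiv.swap 2 3)
  rw [v2 ⟨{0}, by decide⟩ {0} (by decide),
    v2 ⟨{1}, by decide⟩ {1} (by decide),
    v2 ⟨{0, 1}, by decide⟩ {0, 1} (by decide),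
    v2 ⟨{3}, by decide⟩ {2} (by decide),
    v2 ⟨{0, 3}, by decide⟩ {0, 2} (by decide),
    v2 ⟨{1, 3}, by decide⟩ {1, 2} (by decide),
    v2 ⟨{0, 1, 3}, by decide⟩ {0, 1, 2} (by decide),
    v2 ⟨{2}, by decide⟩ {3} (by decide),
    v2 ⟨{0, 2}, by decide⟩ {0, 3} (by decide),
    v2 ⟨{1, 2}, by decide⟩ {1, 3} (by decide),
    v2 ⟨{0, 1, 2}, by decide⟩ {0, 1, 3} (by decide),
    v2 ⟨{2, 3}, by decide⟩ {2, 3} (by decide),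
    v2 ⟨{0, 2, 3}, by decide⟩ {0, 2, 3} (by decide),
    v2 ⟨{1, 2, 3}, by decide⟩ {1, 2, 3} (by decide),
    v2 ⟨{0, 1, 2, 3}, by decide⟩ {0, 1, 2, 3} (by decide)] at i2
  obtain ⟨h3, -, v3, i3⟩ := asym_point hx ((Equiv.swap 0 1).trans (Equiv.swap 2 3))
  rw [v3 ⟨{1}, by decide⟩ {0} (by decide),
    v3 ⟨{0}, by decide⟩ {1} (by decide),
    v3 ⟨{0, 1}, by decide⟩ {0, 1} (by decide),
    v3 ⟨{3}, by decide⟩ {2} (by decide),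
    v3 ⟨{1, 3}, by decide⟩ {0, 2} (by decide),
    v3 ⟨{0, 3}, by decide⟩ {1, 2} (by decide),
    v3 ⟨{0, 1, 3}, by decide⟩ {0, 1, 2} (by decide),
    v3 ⟨{2}, by decide⟩ {3} (by decide),
    v3 ⟨{1, 2}, by decide⟩ {0, 3} (by decide),
    v3 ⟨{0, 2}, by decide⟩ {1, 3} (by decide),
    v3 ⟨{0, 1, 2}, by decide⟩ {0, 1, 3} (by decide),
    v3 ⟨{2, 3}, by decide⟩ {2, 3} (by decide),
    v3 ⟨{1, 2, 3}, by decide⟩ {0, 2, 3} (by decide),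
    v3 ⟨{0, 2, 3}, by decide⟩ {1, 2, 3} (by decide),
    v3 ⟨{0, 1, 2, 3}, by decide⟩ {0, 1, 2, 3} (by decide)] at i3
  unfold Ing4
  linarith

/-- For every almost entropic point `x ∈ Γ̄*_4` the inequality
`Ing(x) + (3/19)·x_{ABCD} ≥ 0` holds. -/
theorem ingleton_bound_almost_entropic (x : EIndex 4 → ℝ)
    (hx : x ∈ closure { y : EIndex 4 → ℝ | IsEntropic y }) :
    Ing4 x + (3 / 19) * x ⟨{0, 1, 2, 3}, by decide⟩ ≥ 0 := by
  have hcl : IsClosed { y : EIndex 4 → ℝ |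
      0 ≤ Ing4 y + (3 / 19) * y ⟨{0, 1, 2, 3}, by decide⟩ } := by
    refine isClosed_le continuous_const ?_
    unfold Ing4
    fun_prop
  exact closure_minimal (fun y hy => entropic_bound hy) hcl hx
end
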